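/- arXiv:math/0503579 — 5 statements merged into one kernel-verified Lean document; each statement's English description precedes it below -/
import Mathlib

section
/- Exponentially tilted conditional expectation of the Brownian sign (Girsanov computation for formula (21)): for 0 ≤ t < u and γ ∈ ℝ, E[ exp( −γ(W_u − W_t) − (γ²/2)(u − t) ) · sgn(W_u) | 𝓕_t ] = 1 − 2Φ( −(W_t − γ(u − t))/√(u − t) ) almost surely. -/
open MeasureTheory ProbabilityTheory

noncomputable section

/-- `W` is a standard one-dimensional Brownian motion on `(Ω, P)`. -/
structure IsStdBM {Ω : Type*} [MeasurableSpace Ω] (P : Measure Ω) (W : ℝ → Ω → ℝ) : Prop where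
  meas : ∀ t : ℝ, Measurable (W t)
  zero : ∀ᵐ ω ∂P, W 0 ω = 0
  cont : ∀ᵐ ω ∂P, ContinuousOn (fun t => W t ω) (Set.Ici 0)
  incr_law : ∀ s t : ℝ, 0 ≤ s → s ≤ t →
    Measure.map (fun ω => W t ω - W s ω) P = gaussianReal 0 (Real.toNNReal (t - s))
  indep_incr : ∀ (k : ℕ) (τ : Fin (k + 1) → ℝ), (∀ i, 0 ≤ τ i) → Monotone τ →
    iIndepFun
      (fun i : Fin k => fun ω => W (τ i.succ) ω - W (τ i.castSucc) ω) P

/-- The natural filtration `𝓕_t = σ(W_s : 0 ≤ s ≤ t)` of the process `W`. -/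
def natFilt {Ω : Type*} [MeasurableSpace Ω] (W : ℝ → Ω → ℝ) (t : ℝ) : MeasurableSpace Ω :=
  ⨆ s ∈ Set.Icc (0 : ℝ) t, MeasurableSpace.comap (W s) inferInstance

/-- The standard normal cumulative distribution function `Φ(x) = γ_{0,1}((−∞, x])`. -/
def stdNormalCDF (x : ℝ) : ℝ := ((gaussianReal 0 1) (Set.Iic x)).toReal


lemma aux_measurable_sign : Measurable Real.sign := by
  unfold Real.sign
  exact Measurable.ite measurableSet_Iio measurable_const
    (Measurable.ite measurableSet_Ioi measurable_const measurable_const)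

lemma aux_abs_sign_le (x : ℝ) : |Real.sign x| ≤ 1 := by
  rcases Real.sign_apply_eq x with h | h | h <;> simp [h]

lemma aux_tilt (v : NNReal) (hv : v ≠ 0) (γ : ℝ) (f : ℝ → ℝ) :
    ∫ y, Real.exp (-γ * y - γ ^ 2 / 2 * v) * f y ∂(gaussianReal 0 v)
      = ∫ y, f y ∂(gaussianReal (-γ * v) v) := by
  rw [integral_gaussianReal_eq_integral_smul hv, integral_gaussianReal_eq_integral_smul hv]
  congr 1
  ext y
  have hv' : (v : ℝ) ≠ 0 := by exact_mod_cast hv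
  simp only [gaussianPDFReal_def, smul_eq_mul]
  rw [← mul_assoc, mul_assoc _ (Real.exp _) (Real.exp _), ← Real.exp_add]
  congr 3
  field_simp
  ring

lemma aux_sign (v : NNReal) (hv : v ≠ 0) (m x : ℝ) :
    ∫ y, Real.sign (x + y) ∂(gaussianReal m v)
      = 1 - 2 * stdNormalCDF (-(x + m) / Real.sqrt v) := by
  have hv' : (0 : ℝ) < v := by exact_mod_cast pos_iff_ne_zero.mpr hv
  have hs : 0 < Real.sqrt v := Real.sqrt_pos.mpr hv'
  have hna := nullSingletonClass_gaussianReal (μ := m) hv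
  have h1 : (fun y => Real.sign (x + y)) =ᵐ[gaussianReal m v]
      fun y => 1 - 2 * (Set.Iic (-x)).indicator (fun _ => (1 : ℝ)) y := by
    have : ∀ᵐ y ∂(gaussianReal m v), y ≠ -x := by
      simp [ae_iff]
    filter_upwards [this] with y hy
    rcases lt_or_gt_of_ne hy with h | h
    · rw [Real.sign_of_neg (by linarith), Set.indicator_of_mem (by exact h.le)]; norm_num
    · rw [Real.sign_of_pos (by linarith), Set.indicator_of_notMem (by simpa using h)]; norm_num
  rw [integral_congr_ae h1, integral_sub (integrable_const _)
    (((integrable_const _).indicator measurableSet_Iic).const_mul _), integral_const_mul,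
    integral_indicator measurableSet_Iic]
  have h2 : gaussianReal m v = ((gaussianReal 0 1).map (Real.sqrt v * ·)).map (m + ·) := by
    rw [gaussianReal_map_const_mul, gaussianReal_map_const_add]
    congr 1
    · simp
    · ext; simp [Real.sq_sqrt hv'.le]
  have h3 : (gaussianReal m v) (Set.Iic (-x))
      = (gaussianReal 0 1) (Set.Iic (-(x + m) / Real.sqrt v)) := by
    rw [h2, Measure.map_apply (by fun_prop) measurableSet_Iic,
      Measure.map_apply (by fun_prop) (measurableSet_Iic.preimage (by fun_prop))]
    congr 1
    ext z
    simp only [Set.mem_preimage, Set.mem_Iic]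
    rw [le_div_iff₀ hs]
    constructor <;> intro h <;> linarith
  simp [stdNormalCDF, Measure.real, h3]

theorem condexp_tilted_sign_brownian {Ω : Type*} [MeasurableSpace Ω] (P : Measure Ω)
    [IsProbabilityMeasure P] (W : ℝ → Ω → ℝ) (hW : IsStdBM P W)
    (hindep : ∀ t u : ℝ, 0 ≤ t → t ≤ u →
      Indep (MeasurableSpace.comap (fun ω => W u ω - W t ω) inferInstance) (natFilt W t) P)
    (t u γ : ℝ) (ht : 0 ≤ t) (htu : t < u) :
    P[(fun ω => Real.exp (-γ * (W u ω - W t ω) - γ ^ 2 / 2 * (u - t)) * Real.sign (W u ω))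
        | natFilt W t]
      =ᵐ[P] fun ω => 1 - 2 * stdNormalCDF (-(W t ω - γ * (u - t)) / Real.sqrt (u - t)) := by
  have hle : natFilt W t ≤ ‹MeasurableSpace Ω› :=
    iSup₂_le fun s _ => (hW.meas s).comap_le
  have hWt : Measurable[natFilt W t] (W t) := by
    apply Measurable.of_comap_le
    exact le_iSup₂_of_le t ⟨ht, le_rfl⟩ le_rfl
  set v : NNReal := Real.toNNReal (u - t) with hvdef
  have hvc : (v : ℝ) = u - t := Real.coe_toNNReal _ (by linarith)
  have hv : v ≠ 0 := by
    intro h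
    rw [h] at hvc
    simp at hvc
    linarith
  set D : Ω → ℝ := fun ω => W u ω - W t ω with hD
  have hDm : Measurable D := (hW.meas u).sub (hW.meas t)
  have hlaw : P.map D = gaussianReal 0 v := hW.incr_law t u ht htu.le
  have hexp : Integrable (fun y => Real.exp (-γ * y - γ ^ 2 / 2 * (u - t))) (gaussianReal 0 v) := by
    simp_rw [Real.exp_sub]
    exact (integrable_exp_mul_gaussianReal (-γ)).div_const _
  have hsm := aux_measurable_sign
  set F : ℝ → ℝ → ℝ := fun x y =>
    Real.exp (-γ * y - γ ^ 2 / 2 * (u - t)) * Real.sign (x + y) with hF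
  set G : ℝ → ℝ := fun x => 1 - 2 * stdNormalCDF (-(x - γ * (u - t)) / Real.sqrt (u - t)) with hG
  have hFG : ∀ x, ∫ y, F x y ∂(gaussianReal 0 v) = G x := by
    intro x
    have := aux_tilt v hv γ (fun y => Real.sign (x + y))
    rw [aux_sign v hv, hvc] at this
    simp only [hF, hG]
    rw [this]
    congr 4
    ring
  have hFm : Measurable (Function.uncurry F) := by
    simp only [hF, Function.uncurry_def]
    exact (by fun_prop : Measurable fun p : ℝ × ℝ =>
      Real.exp (-γ * p.2 - γ ^ 2 / 2 * (u - t))).mul (hsm.comp (by fun_prop))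
  have hGm : Measurable G := by
    have := (hFm.stronglyMeasurable.integral_prod_right (ν := gaussianReal 0 v)).measurable
    simpa only [Function.uncurry, hFG] using this
  have hGb : ∀ x, ‖G x‖ ≤ 1 := by
    intro x
    have h0 : 0 ≤ stdNormalCDF (-(x - γ * (u - t)) / Real.sqrt (u - t)) := ENNReal.toReal_nonneg
    have h1 : stdNormalCDF (-(x - γ * (u - t)) / Real.sqrt (u - t)) ≤ 1 :=
      measureReal_le_one (μ := gaussianReal 0 1)
    rw [Real.norm_eq_abs, abs_le]
    constructor <;> simp only [hG] <;> linarith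
  have hfeq : (fun ω => Real.exp (-γ * (W u ω - W t ω) - γ ^ 2 / 2 * (u - t)) * Real.sign (W u ω))
      = fun ω => F (W t ω) (D ω) := by
    ext ω
    simp [hF, hD]
  have hexpP : Integrable (fun ω => Real.exp (-γ * D ω - γ ^ 2 / 2 * (u - t))) P := by
    rw [← hlaw] at hexp
    exact hexp.comp_measurable hDm
  have hfint : Integrable (fun ω => F (W t ω) (D ω)) P := by
    refine hexpP.mono' (hFm.comp ((hW.meas t).prodMk hDm)).aestronglyMeasurable ?_
    refine ae_of_all _ fun ω => ?_
    simp only [hF, norm_mul, Real.norm_eq_abs, Real.abs_exp]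
    exact mul_le_of_le_one_right (Real.exp_nonneg _) (aux_abs_sign_le _)
  have hgint : Integrable (fun ω => G (W t ω)) P :=
    Integrable.of_bound (hGm.comp (hW.meas t)).aestronglyMeasurable 1 (ae_of_all _ fun ω => hGb _)
  change P[(fun ω => Real.exp (-γ * (W u ω - W t ω) - γ ^ 2 / 2 * (u - t)) * Real.sign (W u ω))
        | natFilt W t] =ᵐ[P] fun ω => G (W t ω)
  rw [hfeq]
  symm
  refine ae_eq_condExp_of_forall_setIntegral_eq hle hfint (fun s _ _ => hgint.integrableOn)
    (fun s hs _ => ?_) (hGm.comp hWt).stronglyMeasurable.aestronglyMeasurable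
  have hs' := hle s hs
  set Z : Ω → ℝ × ℝ := fun ω => (s.indicator (fun _ => (1 : ℝ)) ω, W t ω) with hZ
  have hZm : Measurable[natFilt W t] Z :=
    Measurable.prodMk (Measurable.indicator measurable_const hs) hWt
  have hZm' : Measurable Z := hZm.mono hle le_rfl
  have hI : IndepFun Z D P := by
    rw [IndepFun_iff_Indep]
    exact indep_of_indep_of_le_left (hindep t u ht htu.le).symm hZm.comap_le
  have hmap := (indepFun_iff_map_prod_eq_prod_map_map hZm'.aemeasurable hDm.aemeasurable).mp hI
  rw [hlaw] at hmap
  have hpm : Measurable (fun p : (ℝ × ℝ) × ℝ => p.1.1 * F p.1.2 p.2) :=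
    (by fun_prop : Measurable fun p : (ℝ × ℝ) × ℝ => p.1.1).mul
      (hFm.comp (by fun_prop : Measurable fun p : (ℝ × ℝ) × ℝ => (p.1.2, p.2)))
  have hind : ∀ (f : Ω → ℝ) ω, s.indicator f ω = s.indicator (fun _ => (1 : ℝ)) ω * f ω := by
    intro f ω
    by_cases h : ω ∈ s <;> simp [h]
  have hZD : Measurable (fun ω => (Z ω, D ω)) := hZm'.prodMk hDm
  have hcomp : ∀ ω, s.indicator (fun ω => F (W t ω) (D ω)) ω
      = (fun p : (ℝ × ℝ) × ℝ => p.1.1 * F p.1.2 p.2) (Z ω, D ω) := fun ω => hind _ ω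
  have hpint : Integrable (fun p : (ℝ × ℝ) × ℝ => p.1.1 * F p.1.2 p.2)
      ((P.map Z).prod (gaussianReal 0 v)) := by
    rw [← hmap, integrable_map_measure hpm.aestronglyMeasurable hZD.aemeasurable]
    exact (hfint.indicator hs').congr (ae_of_all _ hcomp)
  rw [← integral_indicator hs', ← integral_indicator hs']
  calc ∫ ω, s.indicator (fun ω => G (W t ω)) ω ∂P
      = ∫ ω, (fun z : ℝ × ℝ => z.1 * G z.2) (Z ω) ∂P := integral_congr_ae (ae_of_all _ (hind _))
    _ = ∫ z, z.1 * G z.2 ∂(P.map Z) := by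
        rw [integral_map hZm'.aemeasurable]
        exact (measurable_fst.mul (hGm.comp measurable_snd)).aestronglyMeasurable
    _ = ∫ p, p.1.1 * F p.1.2 p.2 ∂((P.map Z).prod (gaussianReal 0 v)) := by
        rw [integral_prod _ hpint]
        simp only [integral_const_mul, hFG]
    _ = ∫ ω, s.indicator (fun ω => F (W t ω) (D ω)) ω ∂P := by
        rw [← hmap, integral_map hZD.aemeasurable hpm.aestronglyMeasurable]
        exact integral_congr_ae (ae_of_all _ fun ω => (hcomp ω).symm)

end
end

section
/- Closed form of the linear GSDU under the coarse filtration (formula (19)): for 0 ≤ t ≤ T and γ ∈ ℝ, E[ ∫_t^T Γ_t^s · exp( −γ(W_s − W_t) − (γ²/2)(s − t) ) · W_s ds | 𝓕_t ] = ( ∫_t^T Γ_t^s ds ) · W_t − γ ∫_t^T (s − t) Γ_t^s ds almost surely. -/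
open MeasureTheory ProbabilityTheory

noncomputable section

section helpers

variable {Ω : Type*} [MeasurableSpace Ω] {P : Measure Ω} [IsProbabilityMeasure P]

lemma aux_exp_int {X : Ω → ℝ} (hX : Measurable X) {v : NNReal}
    (h : Measure.map X P = gaussianReal 0 v) (c : ℝ) :
    Integrable (fun ω => Real.exp (c * X ω)) P := by
  have h1 := integrable_exp_mul_gaussianReal (μ := 0) (v := v) c
  rw [← h] at h1
  exact h1.comp_measurable hX

lemma aux_exp_val {X : Ω → ℝ} {v : NNReal}
    (h : Measure.map X P = gaussianReal 0 v) (c : ℝ) :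
    ∫ ω, Real.exp (c * X ω) ∂P = Real.exp (v * c ^ 2 / 2) := by
  have h1 := mgf_gaussianReal h c
  simpa [mgf] using h1

lemma aux_set {X : Ω → ℝ} (hX : Measurable X) {v : NNReal}
    (h : Measure.map X P = gaussianReal 0 v) : integrableExpSet X P = Set.univ := by
  ext c
  simpa [integrableExpSet] using aux_exp_int hX h c

lemma aux_xexp_val {X : Ω → ℝ} (hX : Measurable X) {v : NNReal}
    (h : Measure.map X P = gaussianReal 0 v) (c : ℝ) :
    ∫ ω, X ω * Real.exp (c * X ω) ∂P = v * c * Real.exp (v * c ^ 2 / 2) := by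
  have h1 := hasDerivAt_mgf (X := X) (μ := P) (t := c) (by simp [aux_set hX h])
  have h2 : mgf X P = fun c : ℝ => Real.exp (v * c ^ 2 / 2) := by
    funext c; simpa using mgf_gaussianReal h c
  rw [h2] at h1
  have h3 : HasDerivAt (fun c : ℝ => Real.exp (v * c ^ 2 / 2))
      (Real.exp (v * c ^ 2 / 2) * (v * (2 * c) / 2)) c := by
    have := ((((hasDerivAt_id c).pow 2).const_mul (v : ℝ)).div_const 2).exp
    simpa using this
  rw [h1.unique h3]; ring

lemma aux_xexp_int {X : Ω → ℝ} (hX : Measurable X) {v : NNReal}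
    (h : Measure.map X P = gaussianReal 0 v) (c : ℝ) :
    Integrable (fun ω => X ω * Real.exp (c * X ω)) P := by
  have := integrable_pow_mul_exp_of_mem_interior_integrableExpSet (X := X) (μ := P) (v := c)
    (by simp [aux_set hX h]) 1
  simpa using this

lemma aux_bound (γ x w k : ℝ) (hk : 0 ≤ k) :
    |Real.exp (-γ * x - k) * (x + w)| ≤
      Real.exp ((1 + |γ|) * x) + Real.exp (-(1 + |γ|) * x) + Real.exp (-2 * γ * x) + w ^ 2 := by
  have h1 : Real.exp (-γ * x - k) ≤ Real.exp (-γ * x) := Real.exp_le_exp.2 (by linarith)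
  have h2 : |x| ≤ Real.exp |x| := by linarith [Real.add_one_le_exp |x|]
  have h3 : Real.exp (-γ * x) ≤ Real.exp (|γ| * |x|) := by
    apply Real.exp_le_exp.2
    calc -γ * x ≤ |-γ * x| := le_abs_self _
      _ = _ := by rw [abs_mul, abs_neg]
  have h4 : Real.exp (|γ| * |x|) * Real.exp |x| ≤
      Real.exp ((1 + |γ|) * x) + Real.exp (-(1 + |γ|) * x) := by
    rw [← Real.exp_add]
    rcases abs_cases x with ⟨h, _⟩ | ⟨h, _⟩ <;> rw [h]
    · have := Real.exp_pos (-(1 + |γ|) * x)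
      have e : |γ| * x + x = (1 + |γ|) * x := by ring
      rw [e]; linarith
    · have := Real.exp_pos ((1 + |γ|) * x)
      have e : |γ| * -x + -x = -(1 + |γ|) * x := by ring
      rw [e]; linarith
  have h5 : Real.exp (-γ * x) * |x| ≤ Real.exp (|γ| * |x|) * Real.exp |x| :=
    mul_le_mul h3 h2 (abs_nonneg _) (Real.exp_pos _).le
  have h6 : Real.exp (-2 * γ * x) = Real.exp (-γ * x) ^ 2 := by
    rw [← Real.exp_nat_mul]; congr 1; push_cast; ring
  have h7 : Real.exp (-γ * x) * |w| ≤ Real.exp (-γ * x) ^ 2 + w ^ 2 := by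
    rw [← sq_abs w]
    nlinarith [sq_nonneg (Real.exp (-γ * x) - |w|), sq_nonneg (Real.exp (-γ * x)), sq_nonneg |w|]
  rw [abs_mul, Real.abs_exp, h6]
  calc Real.exp (-γ * x - k) * |x + w| ≤ Real.exp (-γ * x) * (|x| + |w|) :=
        mul_le_mul h1 (abs_add_le _ _) (abs_nonneg _) (Real.exp_pos _).le
    _ ≤ _ := by rw [mul_add]; linarith

variable {W : ℝ → Ω → ℝ}

lemma aux_natFilt_le (hW : IsStdBM P W) (t : ℝ) :
    natFilt W t ≤ (inferInstance : MeasurableSpace Ω) := by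
  refine iSup₂_le fun s _ => (hW.meas s).comap_le

lemma aux_meas_W {t : ℝ} (ht : 0 ≤ t) : Measurable[natFilt W t] (W t) := by
  rw [measurable_iff_comap_le]
  exact le_iSup₂_of_le t ⟨ht, le_rfl⟩ le_rfl

lemma aux_memLp (hW : IsStdBM P W) {t : ℝ} (ht : 0 ≤ t) : MemLp (W t) 2 P := by
  have h := hW.incr_law 0 t le_rfl ht
  have h1 := memLp_id_gaussianReal' (μ := 0) (v := Real.toNNReal (t - 0)) 2 (by simp)
  have hm : Measurable (fun ω => W t ω - W 0 ω) := (hW.meas t).sub (hW.meas 0)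
  rw [← h, memLp_map_measure_iff (by fun_prop) hm.aemeasurable] at h1
  refine h1.ae_eq ?_
  filter_upwards [hW.zero] with ω hω
  simp [hω]

/-- The integrand at a fixed time. -/
lemma aux_slice_int (hW : IsStdBM P W) {t s γ : ℝ} (ht : 0 ≤ t) (hts : t ≤ s) :
    Integrable (fun ω => Real.exp (-γ * (W s ω - W t ω) - γ ^ 2 / 2 * (s - t)) * W s ω) P ∧
    ∫ ω, |Real.exp (-γ * (W s ω - W t ω) - γ ^ 2 / 2 * (s - t)) * W s ω| ∂P ≤
      2 * Real.exp ((s - t) * (1 + |γ|) ^ 2 / 2) + Real.exp ((s - t) * (2 * γ) ^ 2 / 2)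
        + ∫ ω, W t ω ^ 2 ∂P := by
  have hX : Measurable (fun ω => W s ω - W t ω) := (hW.meas s).sub (hW.meas t)
  have hl := hW.incr_law t s ht hts
  have i1 := aux_exp_int hX hl (1 + |γ|)
  have i2 := aux_exp_int hX hl (-(1 + |γ|))
  have i3 := aux_exp_int hX hl (-2 * γ)
  have i4 : Integrable (fun ω => W t ω ^ 2) P := (aux_memLp hW ht).integrable_sq
  have hb : ∀ ω, |Real.exp (-γ * (W s ω - W t ω) - γ ^ 2 / 2 * (s - t)) * W s ω| ≤
      Real.exp ((1 + |γ|) * (W s ω - W t ω)) + Real.exp (-(1 + |γ|) * (W s ω - W t ω))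
        + Real.exp (-2 * γ * (W s ω - W t ω)) + W t ω ^ 2 := fun ω => by
    have := aux_bound γ (W s ω - W t ω) (W t ω) (γ ^ 2 / 2 * (s - t))
      (mul_nonneg (by positivity) (by linarith))
    rwa [sub_add_cancel] at this
  have hi := ((i1.add i2).add i3).add i4
  have hm := hW.meas s
  have hm2 := hW.meas t
  have hint : Integrable
      (fun ω => Real.exp (-γ * (W s ω - W t ω) - γ ^ 2 / 2 * (s - t)) * W s ω) P := by
    refine hi.mono' (Measurable.aestronglyMeasurable (by fun_prop)) (Filter.Eventually.of_forall hb)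
  refine ⟨hint, (integral_mono hint.abs hi hb).trans ?_⟩
  have e1 := aux_exp_val hl (1 + |γ|)
  have e2 := aux_exp_val hl (-(1 + |γ|))
  have e3 := aux_exp_val hl (-2 * γ)
  have c1 : ((Real.toNNReal (s - t) : NNReal) : ℝ) = s - t := Real.coe_toNNReal _ (by linarith)
  rw [c1] at e1 e2 e3
  rw [integral_add' ((i1.add i2).add i3) i4, integral_add' (i1.add i2) i3, integral_add' i1 i2,
    e1, e2, e3]
  apply le_of_eq
  have : (-(1 + |γ|)) ^ 2 = (1 + |γ|) ^ 2 := by ring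
  have h' : (-2 * γ) ^ 2 = (2 * γ) ^ 2 := by ring
  rw [this, h']; ring

lemma aux_slice_val (hW : IsStdBM P W)
    (hindep : ∀ t u : ℝ, 0 ≤ t → t ≤ u →
      Indep (MeasurableSpace.comap (fun ω => W u ω - W t ω) inferInstance) (natFilt W t) P)
    {t s γ : ℝ} (ht : 0 ≤ t) (hts : t ≤ s) {A : Set Ω} (hA : MeasurableSet[natFilt W t] A) :
    ∫ ω in A, Real.exp (-γ * (W s ω - W t ω) - γ ^ 2 / 2 * (s - t)) * W s ω ∂P =
      (∫ ω in A, W t ω ∂P) - γ * (s - t) * P.real A := by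
  have hle := aux_natFilt_le hW t
  have hA' : MeasurableSet A := hle _ hA
  have hX : Measurable (fun ω => W s ω - W t ω) := (hW.meas s).sub (hW.meas t)
  have hl := hW.incr_law t s ht hts
  have c1 : ((Real.toNNReal (s - t) : NNReal) : ℝ) = s - t := Real.coe_toNNReal _ (by linarith)
  have key : ∀ (g : ℝ → ℝ) (_ : Measurable g) (Y : Ω → ℝ) (_ : Measurable[natFilt W t] Y),
      IndepFun (fun ω => g (W s ω - W t ω)) Y P := by
    intro g hg Y hY
    have h0 : IndepFun (fun ω => W s ω - W t ω) Y P := by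
      rw [IndepFun_iff_Indep]
      exact indep_of_indep_of_le_right (hindep t s ht hts) hY.comap_le
    exact h0.comp hg measurable_id
  have hWt := aux_memLp hW ht
  set K := Real.exp (-(γ ^ 2 / 2 * (s - t))) with hK
  have hKe : K * Real.exp ((s - t) * (-γ) ^ 2 / 2) = 1 := by
    rw [hK, ← Real.exp_add, ← Real.exp_zero]; congr 1; ring
  have mY1 : Measurable[natFilt W t] (A.indicator (fun _ => (1 : ℝ))) :=
    (measurable_const).indicator hA
  have mY2 : Measurable[natFilt W t] (A.indicator (W t)) := (aux_meas_W ht).indicator hA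
  have iY1 : Integrable (A.indicator (fun _ => (1 : ℝ))) P := (integrable_const _).indicator hA'
  have iY2 : Integrable (A.indicator (W t)) P := (hWt.integrable (by norm_num)).indicator hA'
  have k1 := key (fun x => x * Real.exp (-γ * x)) (by fun_prop) _ mY1
  have k2 := key (fun x => Real.exp (-γ * x)) (by fun_prop) _ mY2
  have j1 := aux_xexp_int hX hl (-γ)
  have j2 := aux_exp_int hX hl (-γ)
  have v1 := k1.integral_fun_mul_eq_mul_integral j1.aestronglyMeasurable iY1.aestronglyMeasurable
  have v2 := k2.integral_fun_mul_eq_mul_integral j2.aestronglyMeasurable iY2.aestronglyMeasurable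
  have p1 := k1.integrable_mul j1 iY1
  have p2 := k2.integrable_mul j2 iY2
  rw [aux_xexp_val hX hl, integral_indicator hA', c1] at v1
  rw [aux_exp_val hl, integral_indicator hA', c1] at v2
  rw [← integral_indicator hA']
  have : (A.indicator fun ω => Real.exp (-γ * (W s ω - W t ω) - γ ^ 2 / 2 * (s - t)) * W s ω) =
      fun ω => K * (((W s ω - W t ω) * Real.exp (-γ * (W s ω - W t ω))) *
          A.indicator (fun _ => (1 : ℝ)) ω +
        Real.exp (-γ * (W s ω - W t ω)) * A.indicator (W t) ω) := by
    funext ω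
    by_cases h : ω ∈ A
    · simp only [Set.indicator_of_mem h]
      rw [sub_eq_add_neg (-γ * (W s ω - W t ω)), Real.exp_add, ← hK]; ring
    · simp [Set.indicator_of_notMem h]
  rw [this, integral_const_mul]
  have hadd := integral_add p1 p2
  simp only [Pi.mul_apply] at hadd
  rw [hadd, v1, v2]
  simp only [integral_const, smul_eq_mul, mul_one, measureReal_restrict_apply_univ]
  linear_combination ((s - t) * (-γ) * P.real A + ∫ ω in A, W t ω ∂P) * hKe

end helpers

/-- **Closed form of the linear GSDU under the coarse filtration (formula (19)).**
With `Γ_t^s = exp(−∫_t^s β(u) du)`, for `0 ≤ t ≤ T` and `γ ∈ ℝ`,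
`E[∫_t^T Γ_t^s exp(−γ(W_s − W_t) − (γ²/2)(s − t)) W_s ds | 𝓕_t]
  = (∫_t^T Γ_t^s ds) W_t − γ ∫_t^T (s − t) Γ_t^s ds` almost surely. -/
theorem linear_gsdu_coarse_closed_form {Ω : Type*} [MeasurableSpace Ω] (P : Measure Ω)
    [IsProbabilityMeasure P] (W : ℝ → Ω → ℝ) (hW : IsStdBM P W)
    (hindep : ∀ t u : ℝ, 0 ≤ t → t ≤ u →
      Indep (MeasurableSpace.comap (fun ω => W u ω - W t ω) inferInstance) (natFilt W t) P)
    (T : ℝ) (hT : 0 < T) (β : ℝ → ℝ) (hβ : IntegrableOn β (Set.Icc 0 T))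
    (Γ : ℝ → ℝ → ℝ) (hΓ : ∀ t s : ℝ, Γ t s = Real.exp (-∫ u in t..s, β u))
    (t γ : ℝ) (ht : 0 ≤ t) (htT : t ≤ T) :
    P[(fun ω => ∫ s in t..T,
          Γ t s * Real.exp (-γ * (W s ω - W t ω) - γ ^ 2 / 2 * (s - t)) * W s ω)
        | natFilt W t]
      =ᵐ[P] fun ω => (∫ s in t..T, Γ t s) * W t ω - γ * ∫ s in t..T, (s - t) * Γ t s := by
  have hle := aux_natFilt_le hW t
  have hΓc : ContinuousOn (fun s => Γ t s) (Set.Icc t T) := by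
    have hb : IntegrableOn β (Set.uIcc t T) := by
      rw [Set.uIcc_of_le htT]
      exact hβ.mono_set (Set.Icc_subset_Icc_left ht)
    have := intervalIntegral.continuousOn_primitive_interval hb
    rw [Set.uIcc_of_le htT] at this
    simp only [hΓ]
    exact this.neg.rexp
  obtain ⟨M, hM⟩ := isCompact_Icc.exists_bound_of_continuousOn hΓc
  -- a version with continuous paths
  obtain ⟨N, hNsub, hNm, hN0⟩ := exists_measurable_superset_of_null (ae_iff.1 hW.cont)
  classical
  let V : ℝ → Ω → ℝ := fun s ω => if ω ∈ N then 0 else W (max s 0) ω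
  have hVc : ∀ ω, Continuous fun s => V s ω := by
    intro ω
    by_cases h : ω ∈ N
    · simp only [V, if_pos h]; exact continuous_const
    · simp only [V, if_neg h]
      have h1 : ContinuousOn (fun t => W t ω) (Set.Ici 0) := by
        by_contra hc
        exact h (hNsub hc)
      exact h1.comp_continuous (continuous_id.max continuous_const) (fun s => Set.mem_Ici.2 (le_max_right s 0))
  have hVm : ∀ s, Measurable (V s) := fun s =>
    Measurable.ite hNm measurable_const (hW.meas _)
  have hVu : Measurable (Function.uncurry V) :=
    measurable_uncurry_of_continuous_of_measurable hVc hVm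
  have hVW : ∀ᵐ ω ∂P, ∀ s, 0 ≤ s → V s ω = W s ω := by
    have : ∀ᵐ ω ∂P, ω ∉ N := measure_eq_zero_iff_ae_notMem.1 hN0
    filter_upwards [this] with ω hω s hs
    simp [V, hω, max_eq_left hs]
  let f : ℝ → Ω → ℝ := fun s ω =>
    Γ t s * (Real.exp (-γ * (V s ω - V t ω) - γ ^ 2 / 2 * (s - t)) * V s ω)
  let ν : Measure ℝ := volume.restrict (Set.Ioc t T)
  have hfW : ∀ s, t ≤ s → (fun ω => f s ω) =ᵐ[P] fun ω =>
      Γ t s * (Real.exp (-γ * (W s ω - W t ω) - γ ^ 2 / 2 * (s - t)) * W s ω) := by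
    intro s hs
    filter_upwards [hVW] with ω hω
    simp only [f, hω s (ht.trans hs), hω t ht]
  have hνmem : ∀ᵐ s ∂ν, s ∈ Set.Ioc t T := ae_restrict_mem measurableSet_Ioc
  have hfm : AEStronglyMeasurable (Function.uncurry f) (ν.prod P) := by
    have h1 : AEStronglyMeasurable (fun s => Γ t s) ν :=
      (hΓc.mono Set.Ioc_subset_Icc_self).aestronglyMeasurable measurableSet_Ioc
    have h2 : Measurable fun p : ℝ × Ω =>
        Real.exp (-γ * (V p.1 p.2 - V t p.2) - γ ^ 2 / 2 * (p.1 - t)) * V p.1 p.2 := by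
      have a1 : Measurable fun p : ℝ × Ω => V p.1 p.2 := hVu
      have a2 : Measurable fun p : ℝ × Ω => V t p.2 := (hVm t).comp measurable_snd
      fun_prop
    exact h1.comp_fst.mul h2.aestronglyMeasurable
  have hfi : Integrable (Function.uncurry f) (ν.prod P) := by
    rw [integrable_prod_iff hfm]
    refine ⟨?_, ?_⟩
    · filter_upwards [hνmem] with s hs
      refine Integrable.congr ?_ (hfW s hs.1.le).symm
      exact (aux_slice_int hW ht hs.1.le).1.const_mul _
    · refine Integrable.mono' (g := fun _ => M * (2 * Real.exp ((T - t) * (1 + |γ|) ^ 2 / 2) +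
        Real.exp ((T - t) * (2 * γ) ^ 2 / 2) + ∫ ω, W t ω ^ 2 ∂P)) (integrable_const _)
        hfm.norm.integral_prod_right' ?_
      filter_upwards [hνmem] with s hs
      rw [Real.norm_of_nonneg (integral_nonneg fun _ => norm_nonneg _)]
      have e1 : ∫ ω, ‖Function.uncurry f (s, ω)‖ ∂P = ∫ ω, |Γ t s| *
          |Real.exp (-γ * (W s ω - W t ω) - γ ^ 2 / 2 * (s - t)) * W s ω| ∂P := by
        apply integral_congr_ae
        filter_upwards [hfW s hs.1.le] with ω hω
        simp only [Function.uncurry_apply_pair]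
        rw [hω, Real.norm_eq_abs, abs_mul]
      rw [e1, integral_const_mul]
      have hMs := hM s ⟨hs.1.le, hs.2⟩
      rw [Real.norm_eq_abs] at hMs
      refine mul_le_mul hMs ((aux_slice_int hW ht hs.1.le).2.trans ?_)
        (integral_nonneg fun _ => abs_nonneg _) ((abs_nonneg _).trans hMs)
      have := hs.2
      gcongr
  have hF : (fun ω => ∫ s in t..T,
          Γ t s * Real.exp (-γ * (W s ω - W t ω) - γ ^ 2 / 2 * (s - t)) * W s ω)
      =ᵐ[P] fun ω => ∫ s, f s ω ∂ν := by
    filter_upwards [hVW] with ω hω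
    rw [intervalIntegral.integral_of_le htT]
    apply setIntegral_congr_fun measurableSet_Ioc
    intro s hs
    simp only [f, hω s (ht.trans hs.1.le), hω t ht]
    ring
  refine (condExp_congr_ae hF).trans ?_
  have hWi : Integrable (W t) P := (aux_memLp hW ht).integrable (by norm_num)
  have hGi : Integrable (fun ω => (∫ s in t..T, Γ t s) * W t ω
      - γ * ∫ s in t..T, (s - t) * Γ t s) P := (hWi.const_mul _).sub (integrable_const _)
  symm
  refine ae_eq_condExp_of_forall_setIntegral_eq hle hfi.integral_prod_right
    (fun A _ _ => hGi.integrableOn) ?_ ?_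
  · intro A hA _
    have hfA : Integrable (Function.uncurry f) (ν.prod (P.restrict A)) := by
      refine hfi.mono_measure ?_
      exact Measure.prod_mono le_rfl Measure.restrict_le_self
    rw [← integral_integral_swap hfA]
    have e2 : ∫ s, ∫ ω in A, f s ω ∂P ∂ν =
        ∫ s, (Γ t s * (∫ ω in A, W t ω ∂P) - (γ * P.real A) * ((s - t) * Γ t s)) ∂ν := by
      apply integral_congr_ae
      filter_upwards [hνmem] with s hs
      rw [integral_congr_ae (ae_restrict_of_ae (hfW s hs.1.le)), integral_const_mul,
        aux_slice_val hW hindep ht hs.1.le hA]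
      ring
    have g1 : Integrable (fun s => Γ t s) ν :=
      (hΓc.integrableOn_Icc).mono_set Set.Ioc_subset_Icc_self
    have g2 : Integrable (fun s => (s - t) * Γ t s) ν :=
      (((continuous_id.sub continuous_const).continuousOn.mul hΓc).integrableOn_Icc).mono_set
        Set.Ioc_subset_Icc_self
    rw [e2, integral_sub (g1.mul_const _) (g2.const_mul _), integral_mul_const,
      integral_const_mul, integral_sub (hWi.const_mul _).integrableOn (integrable_const _),
      integral_const_mul, intervalIntegral.integral_of_le htT,
      intervalIntegral.integral_of_le htT]
    simp only [integral_const, smul_eq_mul, measureReal_restrict_apply_univ, ν]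
    ring
  · exact (((aux_meas_W ht).const_mul _).sub_const _).stronglyMeasurable.aestronglyMeasurable

end
end

section
/- Failure of information neutrality for the linear GSDU (formula (25)): for T > 0 and γ ∈ ℝ, the two time-0 utilities | E[ ∫_0^T Γ_0^s exp( −(γ/√2)·W_{2s} − (γ²/2)s ) W_s ds ] − E[ ∫_0^T Γ_0^s exp( −γ·W_s − (γ²/2)s ) W_s ds ] | = |γ|·(1 − √2/2)·∫_0^T s·Γ_0^s ds; in particular, whenever γ ≠ 0 the two expectations differ. -/
open MeasureTheory ProbabilityTheory

noncomputable section

/-- Exponential integrability for a real Gaussian variable. -/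
lemma gauss_integrable_exp {Ω : Type*} [MeasurableSpace Ω] (P : Measure Ω)
    (X : Ω → ℝ) (hX : Measurable X) (v : NNReal) (h : P.map X = gaussianReal 0 v) (t : ℝ) :
    Integrable (fun ω => Real.exp (t * X ω)) P := by
  have h1 : Integrable (fun x => Real.exp (t * x)) (P.map X) := by
    rw [h]; exact integrable_exp_mul_gaussianReal t
  exact h1.comp_measurable hX

/-- First exponential moment of a real Gaussian variable. -/
lemma gauss_moment {Ω : Type*} [MeasurableSpace Ω] (P : Measure Ω)
    (X : Ω → ℝ) (hX : Measurable X) (v : NNReal) (h : P.map X = gaussianReal 0 v) (t : ℝ) :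
    ∫ ω, X ω * Real.exp (t * X ω) ∂P = v * t * Real.exp (v * t ^ 2 / 2) := by
  have hset : integrableExpSet X P = Set.univ := by
    ext u
    simpa [integrableExpSet] using gauss_integrable_exp P X hX v h u
  have h1 := hasDerivAt_mgf (X := X) (μ := P) (t := t) (by simp [hset])
  have h2 : mgf X P = fun t => Real.exp (v * t ^ 2 / 2) := by
    funext u
    rw [mgf_gaussianReal h u]; simp
  rw [h2] at h1
  have h3 : HasDerivAt (fun t : ℝ => Real.exp (v * t ^ 2 / 2))
      (Real.exp (v * t ^ 2 / 2) * (v * (2 * t) / 2)) t := by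
    have := (((hasDerivAt_pow 2 t).const_mul (v : ℝ)).div_const 2).exp
    simpa using this
  rw [h1.unique h3]; ring

lemma bm_law {Ω : Type*} [MeasurableSpace Ω] (P : Measure Ω)
    (W : ℝ → Ω → ℝ) (hW : IsStdBM P W) (s : ℝ) (hs : 0 ≤ s) :
    P.map (W s) = gaussianReal 0 (Real.toNNReal s) := by
  have h := hW.incr_law 0 s le_rfl hs
  rw [sub_zero] at h
  rw [← h]
  apply Measure.map_congr
  filter_upwards [hW.zero] with ω h0
  simp [h0]

lemma bm_mgf {Ω : Type*} [MeasurableSpace Ω] (P : Measure Ω)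
    (W : ℝ → Ω → ℝ) (hW : IsStdBM P W) (s : ℝ) (hs : 0 ≤ s) (t : ℝ) :
    ∫ ω, Real.exp (t * W s ω) ∂P = Real.exp (s * t ^ 2 / 2) := by
  have h := mgf_gaussianReal (bm_law P W hW s hs) t
  simpa [mgf, hs] using h

lemma bm_moment {Ω : Type*} [MeasurableSpace Ω] (P : Measure Ω)
    (W : ℝ → Ω → ℝ) (hW : IsStdBM P W) (r : ℝ) (hr : 1 ≤ r) (s : ℝ) (hs : 0 ≤ s) (c : ℝ) :
    ∫ ω, Real.exp (c * W (r * s) ω) * W s ω ∂P = c * s * Real.exp (c ^ 2 * r * s / 2) := by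
  have hsr : s ≤ r * s := by nlinarith
  have hind : IndepFun (W s) (fun ω => W (r * s) ω - W s ω) P := by
    have h := hW.indep_incr 2 ![0, s, r * s]
      (by intro i; fin_cases i <;> simp <;> nlinarith)
      (by
        refine Fin.monotone_iff_le_succ.2 ?_
        intro i; fin_cases i
        · simpa using hs
        · simpa using hsr)
    have h01 := h.indepFun (i := 0) (j := 1) (by decide)
    refine h01.congr ?_ ?_
    · filter_upwards [hW.zero] with ω h0
      simp [h0]
    · filter_upwards with ω
      simp
  have h2 : IndepFun (fun ω => W s ω * Real.exp (c * W s ω))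
      (fun ω => Real.exp (c * (W (r * s) ω - W s ω))) P :=
    hind.comp (φ := fun x : ℝ => x * Real.exp (c * x)) (ψ := fun x : ℝ => Real.exp (c * x))
      (by fun_prop) (by fun_prop)
  have m1 := hW.meas s
  have m2 := hW.meas (r * s)
  have h3 := h2.integral_fun_mul_eq_mul_integral (by fun_prop) (by fun_prop)
  have h4 := gauss_moment P (W s) m1 _ (bm_law P W hW s hs) c
  have h5 := mgf_gaussianReal (hW.incr_law s (r * s) hs hsr) c
  have e1 : ((r * s - s).toNNReal : ℝ) = r * s - s := Real.coe_toNNReal _ (by linarith)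
  simp only [mgf, e1, zero_mul, zero_add] at h5
  rw [Real.coe_toNNReal _ hs] at h4
  rw [h4, h5] at h3
  calc _ = ∫ ω, W s ω * Real.exp (c * W s ω) * Real.exp (c * (W (r * s) ω - W s ω)) ∂P := by
        congr 1; funext ω
        rw [mul_assoc, ← Real.exp_add]; ring_nf
    _ = _ := by
        rw [h3, mul_assoc, ← Real.exp_add]; ring_nf

lemma key_bound (x y : ℝ) :
    |Real.exp y * x| ≤ Real.exp (2 * x) + Real.exp (-2 * x) + Real.exp (2 * y) := by
  have h1 : |x| ≤ Real.exp x + Real.exp (-x) := by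
    have a := Real.add_one_le_exp x
    have b := Real.add_one_le_exp (-x)
    have := Real.exp_pos x
    have := Real.exp_pos (-x)
    rw [abs_le]; constructor <;> linarith
  have e (z : ℝ) : Real.exp (2 * z) = Real.exp z ^ 2 := by rw [← Real.exp_nat_mul]; norm_num
  have e2 : Real.exp (-2 * x) = Real.exp (-x) ^ 2 := by rw [← e]; ring_nf
  rw [abs_mul, abs_of_pos (Real.exp_pos y), e, e, e2]
  have := Real.exp_pos y
  nlinarith [mul_le_mul_of_nonneg_left h1 this.le, sq_nonneg (Real.exp y - Real.exp x - Real.exp (-x)),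
    sq_nonneg (Real.exp x - Real.exp (-x))]

lemma bm_bound {Ω : Type*} [MeasurableSpace Ω] (P : Measure Ω)
    (W : ℝ → Ω → ℝ) (hW : IsStdBM P W) (r : ℝ) (hr : 1 ≤ r) (s : ℝ) (hs : 0 ≤ s) (c : ℝ) :
    Integrable (fun ω => Real.exp (c * W (r * s) ω) * W s ω) P ∧
    ∫ ω, |Real.exp (c * W (r * s) ω) * W s ω| ∂P ≤
      2 * Real.exp (2 * s) + Real.exp (2 * c ^ 2 * r * s) := by
  have hrs : 0 ≤ r * s := by positivity
  have m1 := hW.meas s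
  have m2 := hW.meas (r * s)
  have i1 := gauss_integrable_exp P _ m1 _ (bm_law P W hW s hs) 2
  have i2 := gauss_integrable_exp P _ m1 _ (bm_law P W hW s hs) (-2)
  have i3 := gauss_integrable_exp P _ m2 _ (bm_law P W hW _ hrs) (2 * c)
  have b : ∀ ω, |Real.exp (c * W (r * s) ω) * W s ω| ≤ Real.exp (2 * W s ω) +
      Real.exp (-2 * W s ω) + Real.exp (2 * c * W (r * s) ω) := by
    intro ω
    rw [mul_assoc 2 c]
    exact key_bound _ _
  have hi : Integrable (fun ω => Real.exp (c * W (r * s) ω) * W s ω) P :=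
    ((i1.add i2).add i3).mono' (by fun_prop) (Filter.Eventually.of_forall b)
  refine ⟨hi, ?_⟩
  refine (integral_mono hi.abs ((i1.add i2).add i3) b).trans ?_
  have i12 : Integrable (fun ω => Real.exp (2 * W s ω) + Real.exp (-2 * W s ω)) P := i1.add i2
  have : ∫ ω, (Real.exp (2 * W s ω) + Real.exp (-2 * W s ω) + Real.exp (2 * c * W (r * s) ω)) ∂P
      = 2 * Real.exp (2 * s) + Real.exp (2 * c ^ 2 * r * s) := by
    rw [integral_add i12 i3, integral_add i1 i2, bm_mgf P W hW s hs, bm_mgf P W hW s hs,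
      bm_mgf P W hW _ hrs]
    ring_nf
  exact this.le

/-- A jointly measurable modification. -/
lemma bm_modification {Ω : Type*} [MeasurableSpace Ω] (P : Measure Ω)
    (W : ℝ → Ω → ℝ) (hW : IsStdBM P W) :
    ∃ V : ℝ → Ω → ℝ, Measurable (Function.uncurry V) ∧
      ∀ᵐ ω ∂P, ∀ t, 0 ≤ t → V t ω = W t ω := by
  classical
  set N := toMeasurable P {ω | ¬ ContinuousOn (fun t => W t ω) (Set.Ici 0)} with hN
  have hNm : MeasurableSet N := measurableSet_toMeasurable _ _
  have hN0 : P N = 0 := by rw [hN, measure_toMeasurable]; exact hW.cont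
  refine ⟨fun t ω => if ω ∈ N then 0 else W (max t 0) ω, ?_, ?_⟩
  · apply measurable_uncurry_of_continuous_of_measurable
    · intro ω
      by_cases h : ω ∈ N
      · simp only [h, if_true]; exact continuous_const
      · simp only [h, if_false]
        have hc : ContinuousOn (fun t => W t ω) (Set.Ici 0) := by
          by_contra h'
          exact h (subset_toMeasurable _ _ h')
        exact hc.comp_continuous (f := fun t : ℝ => max t 0) (by fun_prop) (fun t => le_max_right t 0)
    · intro t
      exact Measurable.ite hNm measurable_const (hW.meas _)
  · have : ∀ᵐ ω ∂P, ω ∉ N := measure_eq_zero_iff_ae_notMem.1 hN0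
    filter_upwards [this] with ω h t ht
    simp [h, ht]

lemma utility_eq {Ω : Type*} [MeasurableSpace Ω] (P : Measure Ω)
    [IsProbabilityMeasure P] (W : ℝ → Ω → ℝ) (hW : IsStdBM P W)
    (T : ℝ) (hT : 0 < T) (G : ℝ → ℝ) (hG : ContinuousOn G (Set.Icc 0 T))
    (r : ℝ) (hr : 1 ≤ r) (c k : ℝ) (hk : k = c ^ 2 * r) :
    ∫ ω, (∫ s in (0:ℝ)..T, G s * Real.exp (c * W (r * s) ω - k / 2 * s) * W s ω) ∂P =
      c * ∫ s in (0:ℝ)..T, s * G s := by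
  obtain ⟨V, hVm, hV⟩ := bm_modification P W hW
  have hVt : ∀ t, 0 ≤ t → ∀ᵐ ω ∂P, V t ω = W t ω := fun t ht => hV.mono fun ω h => h t ht
  set μ := (volume : Measure ℝ).restrict (Set.Ioc 0 T) with hμ
  set H : ℝ → ℝ := fun s => G s * Real.exp (- (k / 2 * s)) with hH
  have hHc : ContinuousOn H (Set.Icc 0 T) := hG.mul (by fun_prop)
  set F : ℝ → Ω → ℝ := fun s ω => H s * (Real.exp (c * V (r * s) ω) * V s ω) with hF
  -- replace `W` by `V`
  have s1 : ∫ ω, (∫ s in (0:ℝ)..T, G s * Real.exp (c * W (r * s) ω - k / 2 * s) * W s ω) ∂P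
      = ∫ ω, (∫ s, F s ω ∂μ) ∂P := by
    apply integral_congr_ae
    filter_upwards [hV] with ω h
    rw [intervalIntegral.integral_of_le hT.le]
    apply setIntegral_congr_fun measurableSet_Ioc
    intro s hs
    have hs0 : 0 ≤ s := hs.1.le
    have hrs : 0 ≤ r * s := by positivity
    simp only [hF, hH, h s hs0, h _ hrs, sub_eq_add_neg, Real.exp_add]
    ring
  have hfix : ∀ s, 0 ≤ s → ∀ᵐ ω ∂P, F s ω = H s * (Real.exp (c * W (r * s) ω) * W s ω) := by
    intro s hs
    have hrs : 0 ≤ r * s := by positivity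
    filter_upwards [hV] with ω h
    simp only [hF, h s hs, h _ hrs]
  have hHm : AEStronglyMeasurable H μ :=
    (hHc.mono Set.Ioc_subset_Icc_self).aestronglyMeasurable measurableSet_Ioc
  have hFm : AEStronglyMeasurable (Function.uncurry F) (μ.prod P) := by
    have m1 : Measurable (fun p : ℝ × Ω => V p.1 p.2) := hVm
    have m2 : Measurable (fun p : ℝ × Ω => V (r * p.1) p.2) :=
      hVm.comp ((measurable_fst.const_mul r).prodMk measurable_snd)
    have m3 : Measurable (fun p : ℝ × Ω => Real.exp (c * V (r * p.1) p.2) * V p.1 p.2) := by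
      fun_prop
    exact (hHm.comp_fst).mul m3.aestronglyMeasurable
  have hFi : Integrable (Function.uncurry F) (μ.prod P) := by
    rw [integrable_prod_iff hFm]
    constructor
    · rw [hμ]
      filter_upwards [ae_restrict_mem measurableSet_Ioc] with s hs
      exact ((bm_bound P W hW r hr s hs.1.le c).1.const_mul (H s)).congr
        ((hfix s hs.1.le).mono fun ω h => h.symm)
    · set B : ℝ → ℝ := fun s => |H s| * (2 * Real.exp (2 * s) + Real.exp (2 * c ^ 2 * r * s))
      have hB : ContinuousOn B (Set.Icc 0 T) := hHc.abs.mul (by fun_prop)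
      have hBi : Integrable B μ :=
        (hB.integrableOn_compact isCompact_Icc).mono_set Set.Ioc_subset_Icc_self
      refine hBi.mono' hFm.norm.integral_prod_right' ?_
      rw [hμ]
      filter_upwards [ae_restrict_mem measurableSet_Ioc] with s hs
      have hb := (bm_bound P W hW r hr s hs.1.le c).2
      rw [Real.norm_of_nonneg (integral_nonneg fun _ => norm_nonneg _)]
      have : ∫ ω, ‖Function.uncurry F (s, ω)‖ ∂P
          = |H s| * ∫ ω, |Real.exp (c * W (r * s) ω) * W s ω| ∂P := by
        rw [← integral_const_mul]
        apply integral_congr_ae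
        filter_upwards [hfix s hs.1.le] with ω h
        simp only [Function.uncurry, h, Real.norm_eq_abs, abs_mul]
      rw [this]
      exact mul_le_mul_of_nonneg_left hb (abs_nonneg _)
  rw [s1, ← integral_integral_swap hFi, intervalIntegral.integral_of_le hT.le, ← integral_const_mul]
  apply setIntegral_congr_fun measurableSet_Ioc
  intro s hs
  have hs0 : 0 ≤ s := hs.1.le
  simp only
  rw [integral_congr_ae (hfix s hs0), integral_const_mul, bm_moment P W hW r hr s hs0 c]
  have : Real.exp (-(k / 2 * s)) * Real.exp (c ^ 2 * r * s / 2) = 1 := by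
    rw [← Real.exp_add, hk]; ring_nf; simp
  simp only [hH]
  linear_combination (G s * c * s) * this

/-- **Failure of information neutrality for the linear GSDU (formula (25)).**
For `T > 0` and `γ ∈ ℝ`, the two time-0 utilities satisfy
`|E[∫_0^T Γ_0^s exp(−(γ/√2)·W_{2s} − (γ²/2)s) W_s ds]
   − E[∫_0^T Γ_0^s exp(−γ·W_s − (γ²/2)s) W_s ds]|
  = |γ|·(1 − √2/2)·∫_0^T s·Γ_0^s ds`;
in particular, whenever `γ ≠ 0` the two expectations differ. -/
theorem linear_gsdu_information_nonneutrality {Ω : Type*} [MeasurableSpace Ω] (P : Measure Ω)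
    [IsProbabilityMeasure P] (W : ℝ → Ω → ℝ) (hW : IsStdBM P W)
    (T : ℝ) (hT : 0 < T) (β : ℝ → ℝ) (hβ : IntegrableOn β (Set.Icc 0 T))
    (Γ : ℝ → ℝ → ℝ) (hΓ : ∀ t s : ℝ, Γ t s = Real.exp (-∫ u in t..s, β u)) (γ : ℝ) :
    |(∫ ω, (∫ s in (0:ℝ)..T,
          Γ 0 s * Real.exp (-(γ / Real.sqrt 2) * W (2 * s) ω - γ ^ 2 / 2 * s) * W s ω) ∂P) -
        ∫ ω, (∫ s in (0:ℝ)..T,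
          Γ 0 s * Real.exp (-γ * W s ω - γ ^ 2 / 2 * s) * W s ω) ∂P| =
      |γ| * (1 - Real.sqrt 2 / 2) * ∫ s in (0:ℝ)..T, s * Γ 0 s ∧
    (γ ≠ 0 →
      (∫ ω, (∫ s in (0:ℝ)..T,
          Γ 0 s * Real.exp (-(γ / Real.sqrt 2) * W (2 * s) ω - γ ^ 2 / 2 * s) * W s ω) ∂P) ≠
        ∫ ω, (∫ s in (0:ℝ)..T,
          Γ 0 s * Real.exp (-γ * W s ω - γ ^ 2 / 2 * s) * W s ω) ∂P) := by
  have hG : ContinuousOn (fun s => Γ 0 s) (Set.Icc 0 T) := by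
    have h := intervalIntegral.continuousOn_primitive_interval (μ := volume) (f := β) (a := 0) (b := T)
      (by rwa [Set.uIcc_of_le hT.le])
    rw [Set.uIcc_of_le hT.le] at h
    simp only [hΓ]
    exact h.neg.rexp
  have h2 : (0:ℝ) < Real.sqrt 2 := by positivity
  have h22 : Real.sqrt 2 ^ 2 = 2 := Real.sq_sqrt (by norm_num)
  have hlt : Real.sqrt 2 < 2 := by nlinarith
  have A := utility_eq P W hW T hT (fun s => Γ 0 s) hG 2 (by norm_num) (-(γ / Real.sqrt 2)) (γ ^ 2)
    (by rw [neg_sq, div_pow, h22]; ring)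
  have B := utility_eq P W hW T hT (fun s => Γ 0 s) hG 1 le_rfl (-γ) (γ ^ 2) (by ring)
  simp only [one_mul] at B
  have hpos : 0 < ∫ s in (0:ℝ)..T, s * Γ 0 s := by
    apply intervalIntegral.intervalIntegral_pos_of_pos_on _ _ hT
    · apply ContinuousOn.intervalIntegrable
      rw [Set.uIcc_of_le hT.le]
      exact continuousOn_id.mul hG
    · intro s hs
      rw [hΓ]
      exact mul_pos hs.1 (Real.exp_pos _)
  have hdiv : γ / Real.sqrt 2 = γ * (Real.sqrt 2 / 2) := by
    field_simp
    linear_combination (-γ) * h22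
  have hc : 0 < 1 - Real.sqrt 2 / 2 := by linarith
  rw [A, B]
  have hd : -(γ / Real.sqrt 2) * (∫ s in (0:ℝ)..T, s * Γ 0 s) - -γ * (∫ s in (0:ℝ)..T, s * Γ 0 s)
      = γ * (1 - Real.sqrt 2 / 2) * ∫ s in (0:ℝ)..T, s * Γ 0 s := by
    rw [hdiv]; ring
  refine ⟨?_, ?_⟩
  · rw [hd, abs_mul, abs_mul, abs_of_pos hc, abs_of_pos hpos]
  · intro hγ
    rw [← sub_ne_zero, hd]
    exact mul_ne_zero (mul_ne_zero hγ hc.ne') hpos.ne'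

end
end

section
/- Law of integrated Brownian motion: for T > 0, the random variable ω ↦ ∫_0^T W_s(ω) ds has the Gaussian law with mean 0 and variance T³/3. -/
open MeasureTheory ProbabilityTheory

noncomputable section

lemma ibl_abel (a : ℕ → ℝ) (m : ℕ) :
    ∑ i ∈ Finset.range m, ((m : ℝ) - i) * (a (i + 1) - a i)
      = ∑ i ∈ Finset.range m, a (i + 1) - m * a 0 := by
  induction m with
  | zero => simp
  | succ m ih =>
    have h2 := Finset.sum_range_sub a m
    have h3 : ∑ i ∈ Finset.range m, (((m + 1 : ℕ) : ℝ) - i) * (a (i + 1) - a i)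
        = ∑ i ∈ Finset.range m, ((m : ℝ) - i) * (a (i + 1) - a i)
          + ∑ i ∈ Finset.range m, (a (i + 1) - a i) := by
      rw [← Finset.sum_add_distrib]
      refine Finset.sum_congr rfl fun i _ => ?_
      push_cast
      ring
    rw [Finset.sum_range_succ, Finset.sum_range_succ, h3, ih, h2]
    push_cast
    ring

lemma ibl_sq (m : ℕ) :
    ∑ i ∈ Finset.range m, ((m : ℝ) - i) ^ 2 = m * (m + 1) * (2 * m + 1) / 6 := by
  have h : ∑ i ∈ Finset.range m, ((m : ℝ) - i) ^ 2
      = ∑ i ∈ Finset.range m, ((i : ℝ) + 1) ^ 2 := by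
    rw [← Finset.sum_range_reflect]
    refine Finset.sum_congr rfl fun i hi => ?_
    have := Finset.mem_range.1 hi
    rw [Nat.sub_sub, Nat.cast_sub (by omega)]
    push_cast
    ring
  rw [h]
  clear h
  induction m with
  | zero => simp
  | succ m ih =>
    rw [Finset.sum_range_succ, ih]
    push_cast
    ring

lemma ibl_riemann (f : ℝ → ℝ) (T : ℝ) (hT : 0 < T) (hf : ContinuousOn f (Set.Ici 0)) :
    Filter.Tendsto (fun n : ℕ => ∑ i ∈ Finset.range (n + 1),
      (T / (n + 1 : ℝ)) * f ((i + 1 : ℕ) * (T / (n + 1 : ℝ)))) Filter.atTop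
      (nhds (∫ s in (0:ℝ)..T, f s)) := by
  have huc : UniformContinuousOn f (Set.Icc 0 T) :=
    isCompact_Icc.uniformContinuousOn_of_continuous (hf.mono Set.Icc_subset_Ici_self)
  rw [Metric.uniformContinuousOn_iff] at huc
  rw [Metric.tendsto_atTop]
  intro ε hε
  obtain ⟨δ, hδ, H⟩ := huc (ε / (2 * T)) (by positivity)
  obtain ⟨N, hN⟩ := exists_nat_gt (T / δ)
  refine ⟨N, fun n hn => ?_⟩
  have hn1 : (0 : ℝ) < n + 1 := by positivity
  set h : ℝ := T / (n + 1 : ℝ) with hh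
  have hpos : 0 < h := by positivity
  have hnh : (n + 1 : ℝ) * h = T := by rw [hh]; field_simp
  have hlt : h < δ := by
    rw [hh, div_lt_iff₀ hn1]
    rw [div_lt_iff₀ hδ] at hN
    have : (N : ℝ) ≤ n := by exact_mod_cast hn
    nlinarith
  have hint : ∀ k : ℕ, IntervalIntegrable f volume ((k : ℝ) * h) ((k + 1 : ℕ) * h) := by
    intro k
    apply ContinuousOn.intervalIntegrable
    refine hf.mono ?_
    rw [Set.uIcc_of_le (by push_cast; nlinarith)]
    intro x hx
    have : 0 ≤ (k : ℝ) * h := by positivity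
    exact this.trans hx.1
  have hsum := intervalIntegral.sum_integral_adjacent_intervals (f := f) (μ := volume)
    (a := fun k : ℕ => (k : ℝ) * h) (n := n + 1) (fun k _ => hint k)
  have e1 : ((n + 1 : ℕ) : ℝ) * h = T := by push_cast; exact hnh
  simp only [e1, Nat.cast_zero, zero_mul] at hsum
  rw [← hsum, Real.dist_eq, ← Finset.sum_sub_distrib]
  calc _ ≤ ∑ i ∈ Finset.range (n + 1), ε / (2 * T) * h := by
        refine (Finset.abs_sum_le_sum_abs _ _).trans (Finset.sum_le_sum fun i hi => ?_)
        have hi' : ((i + 1 : ℕ) : ℝ) ≤ n + 1 := by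
          exact_mod_cast Finset.mem_range.1 hi
        have hc : ∫ x in ((i : ℝ) * h)..((i + 1 : ℕ) * h), f ((i + 1 : ℕ) * h)
            = h * f ((i + 1 : ℕ) * h) := by
          rw [intervalIntegral.integral_const, smul_eq_mul]
          push_cast
          ring
        rw [← hc, ← intervalIntegral.integral_sub intervalIntegrable_const (hint i)]
        have := intervalIntegral.norm_integral_le_of_norm_le_const
          (a := (i : ℝ) * h) (b := (i + 1 : ℕ) * h) (C := ε / (2 * T))
          (f := fun x => f ((i + 1 : ℕ) * h) - f x) ?_
        · rw [Real.norm_eq_abs] at this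
          refine this.trans (le_of_eq ?_)
          congr 1
          rw [abs_of_nonneg] <;> push_cast <;> nlinarith
        · intro x hx
          rw [Set.uIoc_of_le (by push_cast; nlinarith)] at hx
          have h0 : 0 ≤ (i : ℝ) * h := by positivity
          have hle : ((i + 1 : ℕ) : ℝ) * h ≤ T := by
            rw [← hnh]
            exact mul_le_mul_of_nonneg_right hi' hpos.le
          have hx1 := hx.1
          have hx2 := hx.2
          refine (H _ ⟨by positivity, hle⟩ x ⟨by linarith, by linarith⟩ ?_).le
          rw [Real.dist_eq, abs_of_nonneg (by linarith)]
          push_cast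
          nlinarith
    _ = ε / 2 := by
        rw [Finset.sum_const, Finset.card_range, nsmul_eq_mul]
        push_cast
        rw [show (n + 1 : ℝ) * (ε / (2 * T) * h) = ε / (2 * T) * ((n + 1 : ℝ) * h) by ring, hnh]
        field_simp
    _ < ε := by linarith

lemma ibl_charFun {Ω : Type*} [MeasurableSpace Ω] (P : Measure Ω)
    [IsProbabilityMeasure P] (W : ℝ → Ω → ℝ) (hW : IsStdBM P W) (h : ℝ) (hh : 0 ≤ h)
    (m : ℕ) (u : ℝ) :
    charFun (P.map (fun ω => ∑ i : Fin m, (h * ((m : ℝ) - (i : ℕ))) *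
        (W ((i + 1 : ℕ) * h) ω - W ((i : ℕ) * h) ω))) u
      = Complex.exp ((-(h ^ 3 * (m * (m + 1) * (2 * m + 1) / 6) * u ^ 2 / 2) : ℝ) : ℂ) := by
  have hmono : Monotone (fun i : Fin (m + 1) => ((i : ℕ) : ℝ) * h) := by
    intro i j hij
    have : ((i : ℕ) : ℝ) ≤ (j : ℕ) := by exact_mod_cast hij
    exact mul_le_mul_of_nonneg_right this hh
  have hind := hW.indep_incr m (fun i => ((i : ℕ) : ℝ) * h) (fun i => by positivity) hmono
  simp only [Fin.val_succ, Fin.val_castSucc] at hind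
  have hind2 : iIndepFun (fun i : Fin m => fun ω => (h * ((m : ℝ) - (i : ℕ))) *
        (W ((i + 1 : ℕ) * h) ω - W ((i : ℕ) * h) ω)) P :=
    hind.comp (fun i : Fin m => fun x : ℝ => (h * ((m : ℝ) - (i : ℕ))) * x)
      (fun i => measurable_const_mul _)
  have hm : ∀ i : ℕ, Measurable (fun ω => W ((i + 1 : ℕ) * h) ω - W ((i : ℕ) * h) ω) :=
    fun i => (hW.meas _).sub (hW.meas _)
  rw [hind2.charFun_map_fun_sum_eq_prod (fun i : Fin m => ((hm (i : ℕ)).const_mul _).aemeasurable)]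
  rw [Finset.prod_apply]
  have key : ∀ i : Fin m, charFun (P.map (fun ω => (h * ((m : ℝ) - (i : ℕ))) *
        (W ((i + 1 : ℕ) * h) ω - W ((i : ℕ) * h) ω))) u
      = Complex.exp ((-(h ^ 3 * u ^ 2 / 2 * ((m : ℝ) - (i : ℕ)) ^ 2) : ℝ) : ℂ) := by
    intro i
    rw [charFun_map_mul_comp (hm i).aemeasurable,
      hW.incr_law _ _ (by positivity) (by push_cast; nlinarith), charFun_gaussianReal]
    have : ((i + 1 : ℕ) : ℝ) * h - (i : ℕ) * h = h := by push_cast; ring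
    rw [this, Real.coe_toNNReal _ hh]
    congr 1
    push_cast
    ring
  simp_rw [key]
  rw [← Complex.exp_sum, ← Complex.ofReal_sum]
  congr 2
  rw [Fin.sum_univ_eq_sum_range (fun i : ℕ => -(h ^ 3 * u ^ 2 / 2 * ((m : ℝ) - i) ^ 2)) m,
    Finset.sum_neg_distrib, ← Finset.mul_sum, ibl_sq]
  ring

lemma ibl_lim (T : ℝ) : Filter.Tendsto (fun n : ℕ => (T / (n + 1 : ℝ)) ^ 3 *
    (((n + 1 : ℕ) : ℝ) * ((n + 1 : ℕ) + 1) * (2 * (n + 1 : ℕ) + 1) / 6)) Filter.atTop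
    (nhds (T ^ 3 / 3)) := by
  have h0 : Filter.Tendsto (fun n : ℕ => 1 / ((n : ℝ) + 1)) Filter.atTop (nhds 0) :=
    tendsto_one_div_add_atTop_nhds_zero_nat
  have h1 : Filter.Tendsto (fun n : ℕ => T ^ 3 * (1 + 1 / ((n : ℝ) + 1)) *
      (2 + 1 / ((n : ℝ) + 1)) / 6) Filter.atTop (nhds (T ^ 3 * (1 + 0) * (2 + 0) / 6)) :=
    ((tendsto_const_nhds.mul (tendsto_const_nhds.add h0)).mul
      (tendsto_const_nhds.add h0)).div_const _
  rw [show T ^ 3 * (1 + 0) * (2 + 0) / 6 = T ^ 3 / 3 by ring] at h1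
  refine h1.congr fun n => ?_
  have : (n : ℝ) + 1 ≠ 0 := by positivity
  push_cast
  field_simp

/-- **Law of integrated Brownian motion.**
For `T > 0`, the random variable `ω ↦ ∫_0^T W_s(ω) ds` has the Gaussian law with mean `0`
and variance `T³/3`. -/
theorem integrated_brownian_law {Ω : Type*} [MeasurableSpace Ω] (P : Measure Ω)
    [IsProbabilityMeasure P] (W : ℝ → Ω → ℝ) (hW : IsStdBM P W) (T : ℝ) (hT : 0 < T) :
    Measure.map (fun ω => ∫ s in (0:ℝ)..T, W s ω) P =
      gaussianReal 0 (Real.toNNReal (T ^ 3 / 3)) := by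
  set S : ℕ → Ω → ℝ := fun n ω => ∑ i : Fin (n + 1),
    ((T / (n + 1 : ℝ)) * (((n + 1 : ℕ) : ℝ) - (i : ℕ))) *
        (W ((i + 1 : ℕ) * (T / (n + 1 : ℝ))) ω - W ((i : ℕ) * (T / (n + 1 : ℝ))) ω) with hS
  have hSm : ∀ n, Measurable (S n) := fun n =>
    Finset.measurable_sum _ fun i _ => ((hW.meas _).sub (hW.meas _)).const_mul _
  have hlim : ∀ᵐ ω ∂P, Filter.Tendsto (fun n => S n ω) Filter.atTop
      (nhds (∫ s in (0:ℝ)..T, W s ω)) := by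
    filter_upwards [hW.zero, hW.cont] with ω h0 hc
    refine (ibl_riemann _ T hT hc).congr fun n => ?_
    have h1 := ibl_abel (fun i : ℕ => W (i * (T / (n + 1 : ℝ))) ω) (n + 1)
    simp only [Nat.cast_zero, zero_mul, h0, mul_zero, sub_zero] at h1
    rw [← Finset.mul_sum, ← h1, hS]
    simp only [mul_assoc]
    rw [← Finset.mul_sum, ← Fin.sum_univ_eq_sum_range
      (fun i : ℕ => (((n + 1 : ℕ) : ℝ) - i) * (W ((i + 1 : ℕ) * (T / (n + 1 : ℝ))) ω
        - W (i * (T / (n + 1 : ℝ))) ω)) (n + 1)]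
  have hIm : AEMeasurable (fun ω => ∫ s in (0:ℝ)..T, W s ω) P :=
    aemeasurable_of_tendsto_metrizable_ae Filter.atTop (fun n => (hSm n).aemeasurable) hlim
  have := Measure.isProbabilityMeasure_map hIm
  refine Measure.ext_of_charFun ?_
  ext u
  have hexp : ∀ Y : Ω → ℝ, AEMeasurable Y P →
      charFun (P.map Y) u = ∫ ω, Complex.exp (u * Y ω * Complex.I) ∂P := by
    intro Y hY
    rw [charFun_apply_real, integral_map hY]
    exact (by fun_prop : Continuous fun x : ℝ =>
      Complex.exp (u * x * Complex.I)).aestronglyMeasurable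
  have hA : Filter.Tendsto (fun n => charFun (P.map (S n)) u) Filter.atTop
      (nhds (charFun (P.map (fun ω => ∫ s in (0:ℝ)..T, W s ω)) u)) := by
    rw [hexp _ hIm]
    simp_rw [fun n => hexp (S n) (hSm n).aemeasurable]
    have hcont : Continuous fun x : ℝ => Complex.exp (u * x * Complex.I) := by fun_prop
    refine tendsto_integral_of_dominated_convergence (fun _ => (1 : ℝ))
      (fun n => (hcont.measurable.comp (hSm n)).aestronglyMeasurable) (integrable_const _)
      (fun n => Filter.Eventually.of_forall fun ω => ?_) ?_
    · rw [← Complex.ofReal_mul, Complex.norm_exp_ofReal_mul_I]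
    · filter_upwards [hlim] with ω hω
      exact (hcont.tendsto _).comp hω
  have hB : Filter.Tendsto (fun n => charFun (P.map (S n)) u) Filter.atTop
      (nhds (Complex.exp ((-(T ^ 3 / 3 * u ^ 2 / 2) : ℝ) : ℂ))) := by
    have h1 := (((ibl_lim T).mul_const (u ^ 2)).div_const 2).neg
    have h2 := (Complex.continuous_exp.comp Complex.continuous_ofReal).tendsto
      (-(T ^ 3 / 3 * u ^ 2 / 2))
    refine (h2.comp h1).congr fun n => ?_
    exact (ibl_charFun P W hW (T / (n + 1 : ℝ)) (by positivity) (n + 1) u).symm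
  rw [tendsto_nhds_unique hA hB, charFun_gaussianReal, Real.coe_toNNReal _ (by positivity)]
  congr 1
  push_cast
  ring

end
end

section
/- Conditional Laplace transform of integrated Brownian motion under the anticipating filtration (quadratic GSDU under 𝓗, Section 4.3): for 0 ≤ t ≤ T/2 and γ ∈ ℝ, E[ exp( −γ ∫_t^T W_s ds ) | 𝓕_{2t} ] = exp( −γ ∫_t^{2t} W_s ds − γ(T − 2t)·W_{2t} + (γ²/6)(T − 2t)³ ) almost surely; equivalently, for γ ≠ 0 the quadratic utility under the anticipating filtration 𝓗_t := 𝓕_{2t}, namely −(1/γ)·log E[ exp( −γ ∫_t^T W_s ds ) | 𝓗_t ], equals ∫_t^{2t} W_s ds + (T − 2t)·W_{2t} − (γ/6)(T − 2t)³ almost surely. -/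
open MeasureTheory ProbabilityTheory

noncomputable section

open Filter Topology

lemma aux_riemann {f : ℝ → ℝ} {a b : ℝ} (hab : a ≤ b) (hf : ContinuousOn f (Set.Icc a b)) :
    Tendsto (fun n : ℕ => (b - a) / ((n : ℝ) + 1) *
      ∑ k ∈ Finset.range (n + 1), f (a + ((k : ℝ) + 1) * ((b - a) / ((n : ℝ) + 1))))
      atTop (𝓝 (∫ s in a..b, f s)) := by
  rw [Metric.tendsto_atTop]
  intro ε hε
  have huc := isCompact_Icc.uniformContinuousOn_of_continuous hf
  rw [Metric.uniformContinuousOn_iff] at huc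
  obtain ⟨δ, hδ, h⟩ := huc (ε / (b - a + 1)) (by apply div_pos hε; linarith)
  have hlim : Tendsto (fun n : ℕ => (b - a) / ((n : ℝ) + 1)) atTop (𝓝 0) :=
    tendsto_const_div_atTop_nhds_zero_nat (b - a) |>.comp (tendsto_add_atTop_nat 1) |>.congr
      (fun n => by simp)
  obtain ⟨N, hN⟩ := (hlim.eventually (gt_mem_nhds hδ)).exists_forall_of_atTop
  refine ⟨N, fun n hn => ?_⟩
  have hstep := hN n hn
  set d := (b - a) / ((n : ℝ) + 1) with hd
  have hd0 : 0 ≤ d := div_nonneg (by linarith) (by positivity)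
  have hdn : ((n : ℝ) + 1) * d = b - a := by rw [hd]; field_simp
  have hmem : ∀ k ≤ n + 1, a + (k : ℝ) * d ∈ Set.Icc a b := by
    intro k hk
    have hk' : (k : ℝ) ≤ (n : ℝ) + 1 := by exact_mod_cast hk
    constructor
    · have : 0 ≤ (k : ℝ) * d := by positivity
      linarith
    · have : (k : ℝ) * d ≤ ((n : ℝ) + 1) * d := by gcongr
      linarith
  have hsub : ∀ k < n + 1, Set.uIcc (a + (k : ℝ) * d) (a + ((k + 1 : ℕ) : ℝ) * d)
      ⊆ Set.Icc a b := fun k hk =>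
    Set.uIcc_subset_Icc (hmem k hk.le) (hmem (k + 1) hk)
  have hint : ∀ k < n + 1, IntervalIntegrable f volume (a + (k : ℝ) * d)
      (a + ((k + 1 : ℕ) : ℝ) * d) := fun k hk =>
    (hf.mono (hsub k hk)).intervalIntegrable
  have hsum := intervalIntegral.sum_integral_adjacent_intervals
    (a := fun k : ℕ => a + (k : ℝ) * d) (f := f) (μ := volume) (n := n + 1) hint
  have e1 : a + ((0 : ℕ) : ℝ) * d = a := by simp
  have e2 : a + ((n + 1 : ℕ) : ℝ) * d = b := by push_cast; linarith
  simp only [e1, e2] at hsum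
  rw [← hsum, Finset.mul_sum, Real.dist_eq, ← Finset.sum_sub_distrib]
  have hterm : ∀ k ∈ Finset.range (n + 1),
      |d * f (a + ((k : ℝ) + 1) * d) - ∫ x in (a + (k : ℝ) * d)..(a + ((k + 1 : ℕ) : ℝ) * d), f x|
        ≤ ε / (b - a + 1) * d := by
    intro k hk
    have hk' := Finset.mem_range.mp hk
    have hlen : a + ((k + 1 : ℕ) : ℝ) * d - (a + (k : ℝ) * d) = d := by push_cast; ring
    have hc : d * f (a + ((k : ℝ) + 1) * d) =
        ∫ x in (a + (k : ℝ) * d)..(a + ((k + 1 : ℕ) : ℝ) * d), f (a + ((k : ℝ) + 1) * d) := by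
      rw [intervalIntegral.integral_const, hlen, smul_eq_mul]
    rw [hc, ← intervalIntegral.integral_sub (by simp) (hint k hk'), ← Real.norm_eq_abs]
    have := intervalIntegral.norm_integral_le_of_norm_le_const
      (f := fun x => f (a + ((k : ℝ) + 1) * d) - f x)
      (a := a + (k : ℝ) * d) (b := a + ((k + 1 : ℕ) : ℝ) * d) (C := ε / (b - a + 1)) (by
        intro x hx
        have hx' := Set.uIoc_subset_uIcc hx
        have hm := hmem (k + 1) hk'
        push_cast at hm
        have := h _ hm x (hsub k hk' hx') (by
          rw [Set.uIcc_of_le (by linarith)] at hx'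
          have h1 := hx'.1
          have h2 := hx'.2
          push_cast at h2
          rw [Real.dist_eq, abs_lt]
          constructor <;> linarith)
        rw [Real.dist_eq] at this
        exact this.le)
    rwa [hlen, abs_of_nonneg hd0] at this
  calc _ ≤ _ := Finset.abs_sum_le_sum_abs _ _
    _ ≤ ∑ k ∈ Finset.range (n + 1), ε / (b - a + 1) * d := Finset.sum_le_sum hterm
    _ = ε / (b - a + 1) * (b - a) := by
      rw [Finset.sum_const, Finset.card_range, nsmul_eq_mul, ← hdn]; push_cast; ring
    _ < ε := by
      rw [div_mul_eq_mul_div, div_lt_iff₀ (by linarith)]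
      nlinarith

lemma aux_abel (u : ℕ → ℝ) (n : ℕ) :
    ∑ k ∈ Finset.range n, (u (k + 1) - u 0) =
      ∑ j ∈ Finset.range n, ((n : ℝ) - j) * (u (j + 1) - u j) := by
  induction n with
  | zero => simp
  | succ n ih =>
    rw [Finset.sum_range_succ, ih, Finset.sum_range_succ, ← Finset.sum_range_sub u (n + 1),
      Finset.sum_range_succ]
    push_cast
    have : ∀ j, ((n : ℝ) + 1 - j) * (u (j + 1) - u j) =
      ((n : ℝ) - j) * (u (j + 1) - u j) + (u (j + 1) - u j) := fun j => by ring
    simp only [this, Finset.sum_add_distrib]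
    ring

lemma aux_sumsq (n : ℕ) :
    ∑ j ∈ Finset.range n, ((n : ℝ) - j) ^ 2 = (n : ℝ) * (n + 1) * (2 * n + 1) / 6 := by
  rw [← Finset.sum_range_reflect]
  have : ∀ j ∈ Finset.range n, ((n : ℝ) - ((n - 1 - j : ℕ) : ℝ)) ^ 2 = ((j : ℝ) + 1) ^ 2 := by
    intro j hj
    have hj' := Finset.mem_range.mp hj
    have : ((n - 1 - j : ℕ) : ℝ) = n - 1 - j := by
      rw [Nat.sub_sub, Nat.cast_sub (by omega)]; push_cast; ring
    rw [this]; ring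
  rw [Finset.sum_congr rfl this]
  clear this
  induction n with
  | zero => simp
  | succ n ih => rw [Finset.sum_range_succ, ih]; push_cast; ring

lemma aux_natFilt_le_s16 {Ω : Type*} [mΩ : MeasurableSpace Ω] {W : ℝ → Ω → ℝ}
    (hm : ∀ t, Measurable (W t)) (t : ℝ) : natFilt W t ≤ mΩ :=
  iSup₂_le fun s _ => (hm s).comap_le

lemma aux_natFilt_mono {Ω : Type*} [MeasurableSpace Ω] {W : ℝ → Ω → ℝ}
    {s t : ℝ} (h : s ≤ t) : natFilt W s ≤ natFilt W t :=
  biSup_mono fun _ hx => ⟨hx.1, hx.2.trans h⟩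

lemma aux_meas {Ω : Type*} [MeasurableSpace Ω] {W : ℝ → Ω → ℝ}
    {s t : ℝ} (h0 : 0 ≤ s) (h : s ≤ t) : Measurable[natFilt W t] (W s) := by
  rw [measurable_iff_comap_le]
  exact le_iSup₂_of_le (f := fun s (_ : s ∈ Set.Icc (0 : ℝ) t) =>
    MeasurableSpace.comap (W s) inferInstance) s ⟨h0, h⟩ le_rfl

/-- product formula for characteristic functions of increments -/
lemma aux_incr {Ω : Type*} [mΩ : MeasurableSpace Ω]
    (P : Measure Ω) [IsProbabilityMeasure P] (W : ℝ → Ω → ℝ) (hW : IsStdBM P W)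
    (hindep : ∀ t u : ℝ, 0 ≤ t → t ≤ u →
      Indep (MeasurableSpace.comap (fun ω => W u ω - W t ω) inferInstance) (natFilt W t) P)
    (τ : ℕ → ℝ) (hτ0 : 0 ≤ τ 0) (hτ : Monotone τ) (c : ℕ → ℝ) (A : Set Ω)
    (hA : MeasurableSet[natFilt W (τ 0)] A) (n : ℕ) :
    Measurable[natFilt W (τ n)] (fun ω => A.indicator (fun _ => (1 : ℂ)) ω *
        Complex.exp ((∑ j ∈ Finset.range n, c j * (W (τ (j + 1)) ω - W (τ j) ω) : ℝ) * Complex.I)) ∧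
    ∫ ω, A.indicator (fun _ => (1 : ℂ)) ω *
        Complex.exp ((∑ j ∈ Finset.range n, c j * (W (τ (j + 1)) ω - W (τ j) ω) : ℝ) * Complex.I) ∂P
      = P.real A * Complex.exp
        ((-(∑ j ∈ Finset.range n, c j ^ 2 * (τ (j + 1) - τ j)) / 2 : ℝ)) := by
  induction n with
  | zero =>
    simp only [Finset.range_zero, Finset.sum_empty, Complex.ofReal_zero, zero_mul, Complex.exp_zero,
      mul_one, neg_zero, zero_div]
    refine ⟨Measurable.indicator measurable_const hA, ?_⟩
    rw [integral_indicator (aux_natFilt_le_s16 hW.meas _ _ hA)]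
    simp
  | succ n ih =>
    have hn0 : 0 ≤ τ n := hτ0.trans (hτ (Nat.zero_le n))
    have hn1 : τ n ≤ τ (n + 1) := hτ n.le_succ
    have heq : ∀ ω, A.indicator (fun _ => (1 : ℂ)) ω * Complex.exp
        ((∑ j ∈ Finset.range (n + 1), c j * (W (τ (j + 1)) ω - W (τ j) ω) : ℝ) * Complex.I) =
        (A.indicator (fun _ => (1 : ℂ)) ω * Complex.exp
        ((∑ j ∈ Finset.range n, c j * (W (τ (j + 1)) ω - W (τ j) ω) : ℝ) * Complex.I)) *
        Complex.exp ((c n : ℂ) * ((W (τ (n + 1)) ω - W (τ n) ω : ℝ) : ℂ) * Complex.I) := by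
      intro ω
      rw [mul_assoc, ← Complex.exp_add, Finset.sum_range_succ]
      congr 2
      push_cast
      ring
    simp only [heq]
    have hD : Measurable[natFilt W (τ (n + 1))] (fun ω => W (τ (n + 1)) ω - W (τ n) ω) :=
      (aux_meas (hn0.trans hn1) le_rfl).sub (aux_meas hn0 hn1)
    have hg : Measurable (fun x : ℝ => Complex.exp ((c n : ℂ) * (x : ℂ) * Complex.I)) := by
      fun_prop
    have hle := aux_natFilt_le_s16 hW.meas
    constructor
    · exact (ih.1.mono (aux_natFilt_mono hn1) le_rfl).mul (hg.comp hD)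
    · have hI : IndepFun (fun ω => A.indicator (fun _ => (1 : ℂ)) ω * Complex.exp
        ((∑ j ∈ Finset.range n, c j * (W (τ (j + 1)) ω - W (τ j) ω) : ℝ) * Complex.I))
        (fun ω => Complex.exp ((c n : ℂ) * ((W (τ (n + 1)) ω - W (τ n) ω : ℝ) : ℂ) * Complex.I))
        P := by
        have h1 := (hindep (τ n) (τ (n + 1)) hn0 hn1).symm
        rw [IndepFun_iff_Indep]
        refine indep_of_indep_of_le_left (indep_of_indep_of_le_right h1 ?_) ih.1.comap_le
        have := (hg.comp (comap_measurable (fun ω => W (τ (n + 1)) ω - W (τ n) ω))).comap_le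
        exact this
      have hDm : Measurable (fun ω => W (τ (n + 1)) ω - W (τ n) ω) := hD.mono (hle _) le_rfl
      rw [hI.integral_fun_mul_eq_mul_integral (ih.1.mono (hle _) le_rfl).aestronglyMeasurable
        (hg.comp hDm).aestronglyMeasurable, ih.2]
      have hcf : ∫ ω, Complex.exp ((c n : ℂ) * ((W (τ (n + 1)) ω - W (τ n) ω : ℝ) : ℂ) * Complex.I) ∂P
          = charFun (gaussianReal 0 (Real.toNNReal (τ (n + 1) - τ n))) (c n) := by
        rw [charFun_apply_real, ← hW.incr_law _ _ hn0 hn1,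
          integral_map hDm.aemeasurable hg.aestronglyMeasurable]
      rw [hcf, charFun_gaussianReal, mul_assoc, ← Complex.exp_add, Finset.sum_range_succ]
      congr 2
      rw [Real.coe_toNNReal _ (by linarith)]
      push_cast
      ring

/-- Riemann sums converge a.s. -/
lemma aux_riemann_ae {Ω : Type*} [mΩ : MeasurableSpace Ω]
    (P : Measure Ω) (W : ℝ → Ω → ℝ) (hW : IsStdBM P W)
    (a b : ℝ) (ha : 0 ≤ a) (hab : a ≤ b) :
    ∀ᵐ ω ∂P, Tendsto (fun n : ℕ => (b - a) / ((n : ℝ) + 1) *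
      ∑ k ∈ Finset.range (n + 1), W (a + ((k : ℝ) + 1) * ((b - a) / ((n : ℝ) + 1))) ω)
      atTop (𝓝 (∫ s in a..b, W s ω)) := by
  filter_upwards [hW.cont] with ω hω
  exact aux_riemann (f := fun s => W s ω) hab (hω.mono fun x hx => ha.trans hx.1)

lemma aux_int_meas {Ω : Type*} [mΩ : MeasurableSpace Ω]
    (P : Measure Ω) (W : ℝ → Ω → ℝ) (hW : IsStdBM P W)
    (a b : ℝ) (ha : 0 ≤ a) (hab : a ≤ b) :
    AEStronglyMeasurable[natFilt W b] (fun ω => ∫ s in a..b, W s ω) P := by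
  refine AEStronglyMeasurable.congr (f := fun ω => limsup (fun n : ℕ => (b - a) / ((n : ℝ) + 1) *
      ∑ k ∈ Finset.range (n + 1), W (a + ((k : ℝ) + 1) * ((b - a) / ((n : ℝ) + 1))) ω) atTop) ?_
      ((aux_riemann_ae P W hW a b ha hab).mono fun ω hω => hω.limsup_eq)
  refine StronglyMeasurable.aestronglyMeasurable (Measurable.stronglyMeasurable ?_)
  refine Measurable.limsup fun n => ?_
  refine Measurable.const_mul (Finset.measurable_fun_sum _ fun k hk => ?_) _
  have hk' : (k : ℝ) + 1 ≤ (n : ℝ) + 1 := by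
    exact_mod_cast Finset.mem_range.mp hk
  have hd : 0 ≤ (b - a) / ((n : ℝ) + 1) := div_nonneg (by linarith) (by positivity)
  have h1 : ((k : ℝ) + 1) * ((b - a) / ((n : ℝ) + 1)) ≤ b - a := by
    calc _ ≤ ((n : ℝ) + 1) * ((b - a) / ((n : ℝ) + 1)) := by gcongr
      _ = b - a := by field_simp
  have h2 : 0 ≤ ((k : ℝ) + 1) * ((b - a) / ((n : ℝ) + 1)) := by positivity
  exact aux_meas (by linarith) (by linarith)

lemma aux_var_lim (L ξ : ℝ) : Tendsto (fun n : ℕ =>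
      ∑ j ∈ Finset.range (n + 1), (ξ * (L / ((n : ℝ) + 1)) * (((n + 1 : ℕ) : ℝ) - j)) ^ 2 *
        (L / ((n : ℝ) + 1))) atTop (𝓝 (ξ ^ 2 * (L ^ 3 / 3))) := by
  have h : ∀ n : ℕ, ∑ j ∈ Finset.range (n + 1),
      (ξ * (L / ((n : ℝ) + 1)) * (((n + 1 : ℕ) : ℝ) - j)) ^ 2 * (L / ((n : ℝ) + 1)) =
      ξ ^ 2 * L ^ 3 / 6 * ((1 + 1 / ((n : ℝ) + 1)) * (2 + 1 / ((n : ℝ) + 1))) := by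
    intro n
    have : ∀ j : ℕ, (ξ * (L / ((n : ℝ) + 1)) * (((n + 1 : ℕ) : ℝ) - j)) ^ 2 * (L / ((n : ℝ) + 1)) =
      ξ ^ 2 * (L / ((n : ℝ) + 1)) ^ 3 * (((n + 1 : ℕ) : ℝ) - j) ^ 2 := fun j => by ring
    simp only [this]
    rw [← Finset.mul_sum, aux_sumsq]
    push_cast
    field_simp
  simp only [h]
  have h1 := tendsto_one_div_add_atTop_nhds_zero_nat (𝕜 := ℝ)
  have := ((h1.const_add 1).mul (h1.const_add 2)).const_mul (ξ ^ 2 * L ^ 3 / 6)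
  convert this using 2
  ring

/-- Joint law of the centered integral and the past. -/
lemma aux_law {Ω : Type*} [mΩ : MeasurableSpace Ω]
    (P : Measure Ω) [IsProbabilityMeasure P] (W : ℝ → Ω → ℝ) (hW : IsStdBM P W)
    (hindep : ∀ t u : ℝ, 0 ≤ t → t ≤ u →
      Indep (MeasurableSpace.comap (fun ω => W u ω - W t ω) inferInstance) (natFilt W t) P)
    (a b : ℝ) (ha : 0 ≤ a) (hab : a ≤ b) :
    AEMeasurable (fun ω => (∫ s in a..b, W s ω) - (b - a) * W a ω) P ∧
    ∀ A, MeasurableSet[natFilt W a] A →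
      (P.restrict A).map (fun ω => (∫ s in a..b, W s ω) - (b - a) * W a ω) =
        P A • gaussianReal 0 (Real.toNNReal ((b - a) ^ 3 / 3)) := by
  have hYm : AEMeasurable (fun ω => (∫ s in a..b, W s ω) - (b - a) * W a ω) P :=
    (((aux_int_meas P W hW a b ha hab).mono (aux_natFilt_le_s16 hW.meas b)).aemeasurable).sub
      ((hW.meas a).const_mul _).aemeasurable
  refine ⟨hYm, fun A hA => ?_⟩
  have hA' := aux_natFilt_le_s16 hW.meas _ _ hA
  have hfin : IsFiniteMeasure (P A • gaussianReal 0 (Real.toNNReal ((b - a) ^ 3 / 3))) :=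
    Measure.smul_finite _ (measure_ne_top P A)
  refine Measure.ext_of_charFun ?_
  ext ξ
  set Y := fun ω => (∫ s in a..b, W s ω) - (b - a) * W a ω with hY
  have hL : 0 ≤ b - a := by linarith
  -- discretisation
  let τ : ℕ → ℕ → ℝ := fun n j => a + (j : ℝ) * ((b - a) / ((n : ℝ) + 1))
  let c : ℕ → ℕ → ℝ := fun n j => ξ * ((b - a) / ((n : ℝ) + 1)) * (((n + 1 : ℕ) : ℝ) - j)
  have hτ0 : ∀ n, τ n 0 = a := fun n => by simp [τ]
  have hτm : ∀ n, Monotone (τ n) := fun n i j hij => by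
    have : (i : ℝ) ≤ j := by exact_mod_cast hij
    simp only [τ]
    gcongr
  have hinc : ∀ n j, τ n (j + 1) - τ n j = (b - a) / ((n : ℝ) + 1) := fun n j => by
    simp only [τ]; push_cast; ring
  have hsum : ∀ n ω, ∑ j ∈ Finset.range (n + 1), c n j * (W (τ n (j + 1)) ω - W (τ n j) ω) =
      ξ * ((b - a) / ((n : ℝ) + 1) * (∑ k ∈ Finset.range (n + 1),
        W (a + ((k : ℝ) + 1) * ((b - a) / ((n : ℝ) + 1))) ω) - (b - a) * W a ω) := by
    intro n ω
    have h1 := aux_abel (fun j => W (τ n j) ω) (n + 1)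
    simp only [c, mul_assoc]
    rw [← Finset.mul_sum, ← Finset.mul_sum, ← h1, Finset.sum_sub_distrib, hτ0]
    simp only [τ, Finset.sum_const, Finset.card_range, nsmul_eq_mul]
    push_cast
    field_simp
  have key := fun n => (aux_incr P W hW hindep (τ n) (by rw [hτ0]; exact ha) (hτm n) (c n) A
    (by rw [hτ0]; exact hA) (n + 1)).2
  have lim1 : Tendsto (fun n => ∫ ω, A.indicator (fun _ => (1 : ℂ)) ω *
        Complex.exp ((∑ j ∈ Finset.range (n + 1),
          c n j * (W (τ n (j + 1)) ω - W (τ n j) ω) : ℝ) * Complex.I) ∂P) atTop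
      (𝓝 (∫ ω, A.indicator (fun _ => (1 : ℂ)) ω * Complex.exp ((ξ * Y ω : ℝ) * Complex.I) ∂P)) := by
    refine tendsto_integral_of_dominated_convergence (fun _ => 1) (fun n => ?_)
      (integrable_const _) (fun n => ?_) ?_
    · exact ((aux_incr P W hW hindep (τ n) (by rw [hτ0]; exact ha) (hτm n) (c n) A
        (by rw [hτ0]; exact hA) (n + 1)).1.mono (aux_natFilt_le_s16 hW.meas _)
          le_rfl).aestronglyMeasurable
    · refine ae_of_all _ fun ω => ?_
      rw [norm_mul, Complex.norm_exp_ofReal_mul_I, mul_one]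
      by_cases h : ω ∈ A <;> simp [h]
    · filter_upwards [aux_riemann_ae P W hW a b ha hab] with ω hω
      simp only [hsum]
      have hc : Continuous (fun x : ℝ => A.indicator (fun _ => (1 : ℂ)) ω *
        Complex.exp ((ξ * (x - (b - a) * W a ω) : ℝ) * Complex.I)) := by fun_prop
      exact (hc.tendsto _).comp hω
  simp only [key] at lim1
  have lim2 : Tendsto (fun n => (P.real A : ℂ) * Complex.exp
        ((-(∑ j ∈ Finset.range (n + 1), c n j ^ 2 * (τ n (j + 1) - τ n j)) / 2 : ℝ))) atTop
      (𝓝 ((P.real A : ℂ) * Complex.exp ((-(ξ ^ 2 * ((b - a) ^ 3 / 3)) / 2 : ℝ)))) := by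
    have hc : Continuous (fun x : ℝ => (P.real A : ℂ) * Complex.exp ((-x / 2 : ℝ))) := by fun_prop
    simp only [hinc]
    exact (hc.tendsto _).comp (aux_var_lim (b - a) ξ)
  have heq := tendsto_nhds_unique lim1 lim2
  have hR : charFun (P A • gaussianReal 0 (Real.toNNReal ((b - a) ^ 3 / 3))) ξ =
      (P.real A : ℂ) * Complex.exp ((-(ξ ^ 2 * ((b - a) ^ 3 / 3)) / 2 : ℝ)) := by
    rw [charFun_apply_real, integral_smul_measure, ← charFun_apply_real, charFun_gaussianReal,
      Real.coe_toNNReal _ (by positivity), Complex.real_smul]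
    congr 2
    push_cast
    ring
  rw [hR, ← heq, charFun_apply_real, integral_map hYm.restrict
    (Measurable.aestronglyMeasurable (by fun_prop)), ← integral_indicator hA']
  refine integral_congr_ae (ae_of_all _ fun ω => ?_)
  by_cases h : ω ∈ A <;> simp [h]

lemma aux_exp_add {Ω : Type*} [mΩ : MeasurableSpace Ω] {P : Measure Ω} {X Y : Ω → ℝ}
    (hX : ∀ c : ℝ, Integrable (fun ω => Real.exp (c * X ω)) P)
    (hY : ∀ c : ℝ, Integrable (fun ω => Real.exp (c * Y ω)) P) (c : ℝ) :
    Integrable (fun ω => Real.exp (c * (X ω + Y ω))) P := by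
  refine ((hX (2 * c)).add (hY (2 * c))).mono' ?_ (ae_of_all _ fun ω => ?_)
  · have := (hX c).aestronglyMeasurable.mul (hY c).aestronglyMeasurable
    refine this.congr (ae_of_all _ fun ω => ?_)
    simp only [Pi.mul_apply]
    rw [← Real.exp_add]; ring_nf
  · have h1 : Real.exp (2 * c * X ω) = Real.exp (c * X ω) ^ 2 := by
      rw [← Real.exp_nat_mul]; push_cast; ring_nf
    have h2 : Real.exp (2 * c * Y ω) = Real.exp (c * Y ω) ^ 2 := by
      rw [← Real.exp_nat_mul]; push_cast; ring_nf
    rw [Real.norm_eq_abs, Real.abs_exp, mul_add, Real.exp_add, Pi.add_apply, h1, h2]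
    nlinarith [sq_nonneg (Real.exp (c * X ω) - Real.exp (c * Y ω)),
      Real.exp_pos (c * X ω), Real.exp_pos (c * Y ω)]

lemma aux_exp_gauss {Ω : Type*} [mΩ : MeasurableSpace Ω] {P : Measure Ω} {X : Ω → ℝ}
    (hXm : AEMeasurable X P) {v : NNReal} (hX : P.map X = gaussianReal 0 v) (c : ℝ) :
    Integrable (fun ω => Real.exp (c * X ω)) P := by
  have := integrable_exp_mul_gaussianReal (μ := 0) (v := v) c
  rw [← hX] at this
  exact this.comp_aemeasurable hXm

lemma aux_main {Ω : Type*} [mΩ : MeasurableSpace Ω]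
    (P : Measure Ω) [IsProbabilityMeasure P] (W : ℝ → Ω → ℝ) (hW : IsStdBM P W)
    (hindep : ∀ t u : ℝ, 0 ≤ t → t ≤ u →
      Indep (MeasurableSpace.comap (fun ω => W u ω - W t ω) inferInstance) (natFilt W t) P)
    (T t γ : ℝ) (ht : 0 ≤ t) (htT : t ≤ T / 2) :
    P[(fun ω => Real.exp (-γ * ∫ s in t..T, W s ω)) | natFilt W (2 * t)]
        =ᵐ[P] fun ω => Real.exp (-γ * (∫ s in t..(2 * t), W s ω) -
          γ * (T - 2 * t) * W (2 * t) ω + γ ^ 2 / 6 * (T - 2 * t) ^ 3) := by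
  have h2t : 0 ≤ 2 * t := by linarith
  have ht2 : t ≤ 2 * t := by linarith
  have hL : 2 * t ≤ T := by linarith
  have hle := aux_natFilt_le_s16 hW.meas (2 * t)
  obtain ⟨hYm, hY⟩ := aux_law P W hW hindep (2 * t) T h2t hL
  obtain ⟨hVm, hV⟩ := aux_law P W hW hindep t (2 * t) ht ht2
  set Y := fun ω => (∫ s in (2 * t)..T, W s ω) - (T - 2 * t) * W (2 * t) ω with hYdef
  set V := fun ω => (∫ s in t..(2 * t), W s ω) - (2 * t - t) * W t ω with hVdef
  have hYl := hY Set.univ MeasurableSet.univ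
  have hVl := hV Set.univ MeasurableSet.univ
  rw [Measure.restrict_univ, measure_univ, one_smul] at hYl hVl
  have iY := aux_exp_gauss hYm hYl
  have iV := aux_exp_gauss hVm hVl
  have iW : ∀ u, 0 ≤ u → ∀ c : ℝ, Integrable (fun ω => Real.exp (c * W u ω)) P := by
    intro u hu c
    refine (aux_exp_gauss ((hW.meas u).sub (hW.meas 0)).aemeasurable
      (hW.incr_law 0 u le_rfl hu) c).congr ?_
    filter_upwards [hW.zero] with ω hω
    simp [hω]
  have iWc : ∀ u, 0 ≤ u → ∀ d c : ℝ, Integrable (fun ω => Real.exp (c * (d * W u ω))) P := by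
    intro u hu d c
    simpa only [mul_assoc] using iW u hu (c * d)
  -- the past part
  set Z := fun ω => (∫ s in t..(2 * t), W s ω) + (T - 2 * t) * W (2 * t) ω with hZdef
  have iZ : ∀ c : ℝ, Integrable (fun ω => Real.exp (c * Z ω)) P := by
    intro c
    have h := aux_exp_add (aux_exp_add iV (iWc t ht (2 * t - t))) (iWc (2 * t) h2t (T - 2 * t)) c
    refine h.congr (ae_of_all _ fun ω => ?_)
    simp only [hZdef, hVdef]
    ring_nf
  have hZm : AEStronglyMeasurable[natFilt W (2 * t)] (fun ω => Real.exp (-γ * Z ω)) P := by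
    have h1 := aux_int_meas P W hW t (2 * t) ht ht2
    have h2 : AEStronglyMeasurable[natFilt W (2 * t)] (fun ω => (T - 2 * t) * W (2 * t) ω) P :=
      (((aux_meas h2t le_rfl).const_mul _).stronglyMeasurable).aestronglyMeasurable
    have hc : Continuous (fun x : ℝ => Real.exp (-γ * x)) := by fun_prop
    exact hc.comp_aestronglyMeasurable (h1.add h2)
  have hprod : (fun ω => Real.exp (-γ * ∫ s in t..T, W s ω)) =ᵐ[P]
      (fun ω => Real.exp (-γ * Z ω)) * (fun ω => Real.exp (-γ * Y ω)) := by
    filter_upwards [hW.cont] with ω hω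
    have hi : ∀ x y, 0 ≤ x → x ≤ y → IntervalIntegrable (fun s => W s ω) volume x y := by
      intro x y hx hxy
      refine (hω.mono ?_).intervalIntegrable
      rw [Set.uIcc_of_le hxy]
      exact fun z hz => hx.trans hz.1
    rw [← intervalIntegral.integral_add_adjacent_intervals (hi t (2 * t) ht ht2)
      (hi (2 * t) T h2t hL), Pi.mul_apply, ← Real.exp_add]
    simp only [hZdef, hYdef]
    ring_nf
  have hint : Integrable ((fun ω => Real.exp (-γ * Z ω)) * (fun ω => Real.exp (-γ * Y ω))) P := by
    refine (aux_exp_add iZ iY (-γ)).congr (ae_of_all _ fun ω => ?_)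
    rw [Pi.mul_apply, ← Real.exp_add]
    ring_nf
  have hcY : (fun _ => Real.exp (γ ^ 2 / 6 * (T - 2 * t) ^ 3)) =ᵐ[P]
      P[(fun ω => Real.exp (-γ * Y ω)) | natFilt W (2 * t)] := by
    refine ae_eq_condExp_of_forall_setIntegral_eq hle (iY (-γ))
      (fun s _ _ => (integrable_const _).integrableOn) (fun s hs _ => ?_)
      aestronglyMeasurable_const
    have hg : Measurable (fun y : ℝ => Real.exp (-γ * y)) := by fun_prop
    have h1 := integral_map (μ := P.restrict s) (φ := Y) hYm.restrict
      (f := fun y : ℝ => Real.exp (-γ * y)) hg.aestronglyMeasurable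
    have h2 : ∫ y, Real.exp (-γ * y) ∂(gaussianReal 0 (Real.toNNReal ((T - 2 * t) ^ 3 / 3))) =
        Real.exp (γ ^ 2 / 6 * (T - 2 * t) ^ 3) := by
      have := congrFun (mgf_fun_id_gaussianReal (μ := 0)
        (v := Real.toNNReal ((T - 2 * t) ^ 3 / 3))) (-γ)
      rw [mgf] at this
      have h0 : 0 ≤ T - 2 * t := by linarith
      rw [this, Real.coe_toNNReal _ (by positivity)]
      ring_nf
    rw [← h1, hY s hs, integral_smul_measure, h2, setIntegral_const]
    rfl
  refine (condExp_congr_ae hprod).trans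
    ((condExp_mul_of_aestronglyMeasurable_left hZm hint (iY (-γ))).trans ?_)
  filter_upwards [hcY] with ω hω
  rw [Pi.mul_apply, ← hω, ← Real.exp_add]
  simp only [hZdef]
  ring_nf

/-- **Conditional Laplace transform of integrated Brownian motion under the anticipating
filtration** (quadratic GSDU under `𝓗`, Section 4.3): for `0 ≤ t ≤ T/2` and `γ ∈ ℝ`,
`E[exp(−γ ∫_t^T W_s ds) | 𝓕_{2t}]
  = exp(−γ ∫_t^{2t} W_s ds − γ(T − 2t)·W_{2t} + (γ²/6)(T − 2t)³)` almost surely;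
equivalently, for `γ ≠ 0`, the quadratic utility under the anticipating filtration
`𝓗_t := 𝓕_{2t}`, namely `−(1/γ)·log E[exp(−γ ∫_t^T W_s ds) | 𝓗_t]`, equals
`∫_t^{2t} W_s ds + (T − 2t)·W_{2t} − (γ/6)(T − 2t)³` almost surely. -/
theorem condexp_laplace_integrated_brownian_anticipating {Ω : Type*} [MeasurableSpace Ω]
    (P : Measure Ω) [IsProbabilityMeasure P] (W : ℝ → Ω → ℝ) (hW : IsStdBM P W)
    (hindep : ∀ t u : ℝ, 0 ≤ t → t ≤ u →
      Indep (MeasurableSpace.comap (fun ω => W u ω - W t ω) inferInstance) (natFilt W t) P)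
    (T t γ : ℝ) (ht : 0 ≤ t) (htT : t ≤ T / 2) :
    (P[(fun ω => Real.exp (-γ * ∫ s in t..T, W s ω)) | natFilt W (2 * t)]
        =ᵐ[P] fun ω => Real.exp (-γ * (∫ s in t..(2 * t), W s ω) -
          γ * (T - 2 * t) * W (2 * t) ω + γ ^ 2 / 6 * (T - 2 * t) ^ 3)) ∧
      (γ ≠ 0 →
        (fun ω => -(1 / γ) * Real.log
            ((P[(fun ω => Real.exp (-γ * ∫ s in t..T, W s ω)) | natFilt W (2 * t)]) ω))
          =ᵐ[P] fun ω => (∫ s in t..(2 * t), W s ω) + (T - 2 * t) * W (2 * t) ω -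
            γ / 6 * (T - 2 * t) ^ 3) := by
  have h := aux_main P W hW hindep T t γ ht htT
  refine ⟨h, fun hγ => ?_⟩
  filter_upwards [h] with ω hω
  rw [hω, Real.log_exp]
  field_simp
  ring

end
end
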